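/- arXiv:math/0610421 — 3 statements merged into one kernel-verified Lean document; each statement's English description precedes it below -/
import Mathlib

section
/- Let K be a compact Hausdorff space and let m be a natural number or ∞. If C(K) admits a bump function of class C^m, then C(K) admits partitions of unity of class C^m. -/
universe u

/-- A bump function of class `C^m` on a real Banach space: a `C^m` function that is not
identically zero but vanishes outside some bounded set. -/
def IsBumpOfClass {X : Type*} [NormedAddCommGroup X] [NormedSpace ℝ X]
    (m : ℕ∞) (b : X → ℝ) : Prop :=
  ContDiff ℝ (m : WithTop ℕ∞) b ∧ (∃ x, b x ≠ 0) ∧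
    ∃ s : Set X, Bornology.IsBounded s ∧ ∀ x ∉ s, b x = 0

/-- A real Banach space `X` admits partitions of unity of class `C^m`: for every open cover
of `X` there is a locally finite family of `[0,1]`-valued `C^m` functions, with supports
subordinated to the cover, summing to `1` at every point. -/
def AdmitsPartitionsOfUnity (X : Type u) [NormedAddCommGroup X] [NormedSpace ℝ X]
    (m : ℕ∞) : Prop :=
  ∀ 𝒰 : Set (Set X), (∀ U ∈ 𝒰, IsOpen U) → ⋃₀ 𝒰 = Set.univ →
    ∃ (I : Type u) (ψ : I → X → ℝ),
      (∀ i, ContDiff ℝ (m : WithTop ℕ∞) (ψ i)) ∧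
      (∀ i x, ψ i x ∈ Set.Icc (0 : ℝ) 1) ∧
      (LocallyFinite fun i => tsupport (ψ i)) ∧
      (∀ i, ∃ U ∈ 𝒰, tsupport (ψ i) ⊆ U) ∧
      (∀ x, HasSum (fun i => ψ i x) 1)

theorem ekeland_aux {X : Type*} [MetricSpace X] [CompleteSpace X] (P : X → ℝ → Prop)
    (hP : ∀ x s, P x s → s ≤ 1) (hne : ∃ x s, P x s) :
    ∃ x, ∀ ρ > 0, ∃ y s, P y s ∧ dist y x < ρ ∧
      ∀ y' s', P y' s' → dist y y' ≤ s' - s → s' - s < ρ := by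
  have step : ∀ σ : {q : X × ℝ // P q.1 q.2}, ∃ τ : {q : X × ℝ // P q.1 q.2},
      dist σ.1.1 τ.1.1 ≤ τ.1.2 - σ.1.2 ∧
      ∀ y' s', P y' s' → dist σ.1.1 y' ≤ s' - σ.1.2 → s' - σ.1.2 ≤ 2 * (τ.1.2 - σ.1.2) := by
    rintro ⟨⟨x, s⟩, h⟩
    by_cases hall : ∀ y' s', P y' s' → dist x y' ≤ s' - s → s' - s ≤ 0
    · refine ⟨⟨⟨x, s⟩, h⟩, by simp, ?_⟩
      intro y' s' h1 h2
      have := hall y' s' h1 h2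
      simpa using this
    · push Not at hall
      obtain ⟨y0, s0, h0, hd0, hs0⟩ := hall
      let E : Set ℝ := {δ | ∃ y', P y' (s + δ) ∧ dist x y' ≤ δ}
      have hb : BddAbove E := ⟨1 - s, by
        rintro δ ⟨y', h1, -⟩
        have := hP _ _ h1
        linarith⟩
      have hmem : s0 - s ∈ E := ⟨y0, by simpa using h0, hd0⟩
      have hpos : 0 < sSup E := lt_of_lt_of_le hs0 (le_csSup hb hmem)
      obtain ⟨δ, ⟨y', h1, h2⟩, h3⟩ := exists_lt_of_lt_csSup ⟨_, hmem⟩ (half_lt_self hpos)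
      refine ⟨⟨⟨y', s + δ⟩, h1⟩, by simpa using h2, ?_⟩
      intro y'' s'' h4 h5
      have : s'' - s ≤ sSup E := le_csSup hb ⟨y'', by simpa using h4, h5⟩
      simp only at *
      linarith
  choose g hg1 hg2 using step
  obtain ⟨x0, s0, h0⟩ := hne
  let σ : ℕ → {q : X × ℝ // P q.1 q.2} := fun n => g^[n] ⟨⟨x0, s0⟩, h0⟩
  have hσ : ∀ n, σ (n+1) = g (σ n) := fun n => Function.iterate_succ_apply' _ _ _
  have hmono : Monotone fun n => (σ n).1.2 := by
    apply monotone_nat_of_le_succ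
    intro n
    have := hg1 (σ n)
    rw [← hσ] at this
    have := this.trans' dist_nonneg
    linarith
  have hbd : BddAbove (Set.range fun n => (σ n).1.2) := ⟨1, by
    rintro _ ⟨n, rfl⟩
    exact hP _ _ (σ n).2⟩
  have hlim := tendsto_atTop_ciSup hmono hbd
  have hcs : CauchySeq fun n => (σ n).1.1 := by
    have hd : ∀ n k, dist (σ n).1.1 (σ (n+k)).1.1 ≤ (σ (n+k)).1.2 - (σ n).1.2 := by
      intro n k
      induction k with
      | zero => simp
      | succ k ih =>
        have := hg1 (σ (n+k))
        rw [← hσ] at this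
        have h2 := dist_triangle (σ n).1.1 (σ (n+k)).1.1 (σ (n+(k+1))).1.1
        rw [← add_assoc] at *
        linarith
    refine cauchySeq_of_le_tendsto_0 (fun n => 2 * ((⨆ n, (σ n).1.2) - (σ n).1.2)) ?_ ?_
    · intro n k N hn hk
      obtain ⟨i, rfl⟩ := Nat.exists_eq_add_of_le hn
      obtain ⟨j, rfl⟩ := Nat.exists_eq_add_of_le hk
      have := dist_triangle_left (σ (N+i)).1.1 (σ (N+j)).1.1 (σ N).1.1
      have h1 := hd N i
      have h2 := hd N j
      have h3 := le_ciSup hbd (N+i)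
      have h4 := le_ciSup hbd (N+j)
      linarith
    · have := (hlim.const_sub (⨆ n, (σ n).1.2)).const_mul 2
      simpa using this
  obtain ⟨x, hx⟩ := cauchySeq_tendsto_of_complete hcs
  refine ⟨x, fun ρ hρ => ?_⟩
  have hdiff : Filter.Tendsto (fun n => (σ (n+1)).1.2 - (σ n).1.2) Filter.atTop (nhds 0) := by
    have := (hlim.comp (Filter.tendsto_add_atTop_nat 1)).sub hlim
    simpa using this
  obtain ⟨n, h1, h2⟩ := ((hdiff.eventually (gt_mem_nhds (half_pos hρ))).and
    (hx.eventually (Metric.ball_mem_nhds x hρ))).exists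
  refine ⟨(σ n).1.1, (σ n).1.2, (σ n).2, h2, ?_⟩
  intro y' s' h3 h4
  have := hg2 (σ n) y' s' h3 h4
  rw [← hσ] at this
  linarith

theorem gap_aux {K : Type*} [TopologicalSpace K] [CompactSpace K]
    (φ : C(K, ℝ) → ℝ) (hφ : ContDiff ℝ 1 φ) (h0 : 0 < φ 0)
    (h1 : ∀ g, 1 ≤ ‖g‖ → φ g = 0) (f : C(K, ℝ)) (a b : ℝ) (hab : a < b) :
    ∃ y, a < y ∧ y < b ∧ ∀ t, f t ≠ y := by
  by_contra hcon
  push Not at hcon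
  let P : C(K, ℝ) → ℝ → Prop := fun x s => 0 ≤ s ∧ s < 1 ∧ φ 0 * (1 - s / 2) ≤ φ x ∧
    ∃ c d, a < c ∧ c < d ∧ d < b ∧ ∀ t, c ≤ f t → f t ≤ d → x t = s
  obtain ⟨x, hx⟩ := ekeland_aux P (fun x s h => h.2.1.le) ⟨0, 0, le_rfl, one_pos, by simp,
    a + (b-a)/3, b - (b-a)/3, by linarith, by linarith, by linarith, by simp⟩
  have hs : HasStrictFDerivAt φ (fderiv ℝ φ x) x :=
    hφ.contDiffAt.hasStrictFDerivAt one_ne_zero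
  set L := fderiv ℝ φ x
  have := hs.isLittleO.def (half_pos h0)
  rw [nhds_prod_eq, Filter.eventually_iff, ← nhds_prod_eq, Metric.mem_nhds_iff] at this
  obtain ⟨ρ, hρ, hsub⟩ := this
  set δ := min (ρ/2) (1/2) with hδ
  have hδ0 : 0 < δ := by positivity
  have hδ1 : δ ≤ ρ/2 := min_le_left _ _
  have hδ2 : δ ≤ 1/2 := min_le_right _ _
  obtain ⟨y, s, ⟨hs0, hs1, hφy, c, d, hac, hcd, hdb, hyc⟩, hyx, hmax⟩ := hx δ hδ0
  -- general step
  have key : ∀ (w : C(K, ℝ)) (c' d' : ℝ), a < c' → c' < d' → d' < b → c ≤ c' → d' ≤ d →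
      (∀ t, |w t| ≤ 1) → (∀ t, c' ≤ f t → f t ≤ d' → w t = 1) → 0 ≤ L w → False := by
    intro w c' d' h2 h3 h4 h5 h6 hw hw1 hL
    have hnw : ‖w‖ ≤ 1 := (ContinuousMap.norm_le _ zero_le_one).2 hw
    have hdist : dist y (y + δ • w) ≤ δ := by
      rw [dist_eq_norm, sub_add_cancel_left, norm_neg, norm_smul, Real.norm_of_nonneg hδ0.le]
      nlinarith
    have hin : (y + δ • w, y) ∈ Metric.ball (x, x) ρ := by
      rw [Metric.mem_ball, Prod.dist_eq, max_lt_iff]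
      have := dist_triangle_left (y + δ • w) x y
      constructor <;> simp only <;> linarith
    have h7 := hsub hin
    simp only [Set.mem_ofPred_eq, add_sub_cancel_left, map_smul, smul_eq_mul, norm_smul,
      Real.norm_of_nonneg hδ0.le] at h7
    have h8 := (abs_le.1 h7).1
    have h9 : φ 0 * (1 - (s+δ)/2) ≤ φ (y + δ • w) := by
      have : 0 ≤ δ * L w := by positivity
      have : φ 0 / 2 * (δ * ‖w‖) ≤ φ 0 / 2 * δ := by
        gcongr; nlinarith
      nlinarith
    have h10 : ∀ t, c' ≤ f t → f t ≤ d' → (y + δ • w) t = s + δ := by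
      intro t ht1 ht2
      simp [hyc t (h5.trans ht1) (ht2.trans h6), hw1 t ht1 ht2]
    have h11 : s + δ < 1 := by
      by_contra hge
      push Not at hge
      obtain ⟨t, ht⟩ := hcon c' h2 (h3.trans h4)
      have h12 := h10 t ht.ge (ht.le.trans h3.le)
      have h13 := (y + δ • w).norm_coe_le_norm t
      rw [h12, Real.norm_of_nonneg (by linarith)] at h13
      rw [h1 _ (hge.trans h13)] at h9
      nlinarith
    have := hmax (y + δ • w) (s + δ) ⟨by linarith, h11, h9, c', d', h2, h3, h4, h10⟩ (by linarith)
    linarith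
  let k := 6 / (d - c)
  have hdc : 0 < d - c := by linarith
  let v : C(K, ℝ) := ⟨fun t => max (-1) (min 1 (k * ((c + d) / 2 - f t))), by fun_prop⟩
  have hv : ∀ t, |v t| ≤ 1 := by
    intro t
    rw [abs_le]
    exact ⟨le_max_left _ _, max_le (by norm_num) (min_le_left _ _)⟩
  have hk : k * ((d - c) / 6) = 1 := by simp only [k]; field_simp
  have hk0 : 0 < k := by positivity
  rcases le_total 0 (L v) with hL | hL
  · refine key v c (c + (d-c)/3) hac (by linarith) (by linarith) le_rfl (by linarith) hv ?_ hL
    intro t _ ht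
    have : 1 ≤ k * ((c + d) / 2 - f t) := by
      rw [← hk]; gcongr; linarith
    simp only [v, ContinuousMap.coe_mk]
    rw [min_eq_left this, max_eq_right (by norm_num)]
  · refine key (-v) (d - (d-c)/3) d (by linarith) (by linarith) (by linarith) (by linarith)
      le_rfl (by simpa using hv) ?_ (by simpa using hL)
    intro t ht _
    have : k * ((c + d) / 2 - f t) ≤ -1 := by
      rw [← hk, ← mul_neg]; gcongr; linarith
    simp only [v, ContinuousMap.coe_mk, ContinuousMap.neg_apply]
    rw [min_eq_right (by linarith), max_eq_left this]; norm_num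

theorem gap_rat {K : Type*} [TopologicalSpace K] [CompactSpace K]
    (φ : C(K, ℝ) → ℝ) (hφ : ContDiff ℝ 1 φ) (h0 : 0 < φ 0)
    (h1 : ∀ g, 1 ≤ ‖g‖ → φ g = 0) (f : C(K, ℝ)) (a b : ℝ) (hab : a < b) :
    ∃ q : ℚ, a < q ∧ q < b ∧ ∀ t, f t ≠ q := by
  obtain ⟨y, hy1, hy2, hy3⟩ := gap_aux φ hφ h0 h1 f a b hab
  have ho : IsOpen (Set.Ioo a b ∩ (Set.range f)ᶜ) :=
    isOpen_Ioo.inter (isCompact_range f.continuous).isClosed.isOpen_compl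
  obtain ⟨q, ⟨h2, h3⟩, h4⟩ := (Rat.denseRange_cast (𝕜 := ℝ)).exists_mem_open ho
    ⟨y, ⟨hy1, hy2⟩, by rintro ⟨t, ht⟩; exact hy3 t ht⟩
  exact ⟨q, h2, h3, fun t ht => h4 ⟨t, ht⟩⟩

theorem contDiff_finsum_aux {X ι : Type*} [NormedAddCommGroup X] [NormedSpace ℝ X] {m : ℕ∞}
    (f : ι → X → ℝ) (hf : ∀ i, ContDiff ℝ (m : WithTop ℕ∞) (f i))
    (hl : LocallyFinite fun i => Function.support (f i)) :
    ContDiff ℝ (m : WithTop ℕ∞) fun x => ∑ᶠ i, f i x :=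
  contMDiff_iff_contDiff.1 (contMDiff_finsum (fun i => (hf i).contMDiff) hl)

theorem pu_of_base {X A : Type u} [NormedAddCommGroup X] [NormedSpace ℝ X] (m : ℕ∞)
    (ψ : ℕ → A → X → ℝ) (hψ : ∀ n a, ContDiff ℝ (m : WithTop ℕ∞) (ψ n a))
    (hnn : ∀ n a x, 0 ≤ ψ n a x)
    (hlf : ∀ n, LocallyFinite fun a => Function.support (ψ n a))
    (hbase : ∀ x, ∀ ε > 0, ∃ n a, 0 < ψ n a x ∧ tsupport (ψ n a) ⊆ Metric.ball x ε) :
    AdmitsPartitionsOfUnity X m := by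
  classical
  intro 𝒰 hopen hcov
  let χ : ℕ → A → X → ℝ := fun n a => if ∃ U ∈ 𝒰, tsupport (ψ n a) ⊆ U then ψ n a else fun _ => 0
  have hχ : ∀ n a, ContDiff ℝ (m : WithTop ℕ∞) (χ n a) := by
    intro n a; simp only [χ]; split_ifs
    · exact hψ n a
    · exact contDiff_const
  have hχ0 : ∀ n a x, 0 ≤ χ n a x := by
    intro n a x; simp only [χ]; split_ifs
    · exact hnn n a x
    · exact le_rfl
  have hχsub : ∀ n a, ∃ U ∈ 𝒰, tsupport (χ n a) ⊆ U := by
    intro n a; simp only [χ]; split_ifs with h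
    · exact h
    · obtain ⟨U, hU, -⟩ : (0 : X) ∈ ⋃₀ 𝒰 := by rw [hcov]; trivial
      refine ⟨U, hU, ?_⟩
      have : tsupport (fun _ : X => (0:ℝ)) = ∅ := by rw [tsupport_eq_empty_iff]; rfl
      rw [this]; exact Set.empty_subset _
  have hχlf : ∀ n, LocallyFinite fun a => Function.support (χ n a) := by
    intro n
    refine (hlf n).subset fun a => ?_
    simp only [χ]; split_ifs
    · exact subset_rfl
    · simp
  have hχpos : ∀ x, ∃ n a, 0 < χ n a x := by
    intro x
    obtain ⟨U, hU, hx⟩ : x ∈ ⋃₀ 𝒰 := by rw [hcov]; trivial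
    obtain ⟨ε, hε, hb⟩ := Metric.isOpen_iff.1 (hopen U hU) x hx
    obtain ⟨n, a, h1, h2⟩ := hbase x ε hε
    refine ⟨n, a, ?_⟩
    simp only [χ]
    rw [if_pos ⟨U, hU, h2.trans hb⟩]
    exact h1
  let g : ℕ → X → ℝ := fun n x => ∑ᶠ a, χ n a x
  have hg : ∀ n, ContDiff ℝ (m : WithTop ℕ∞) (g n) := fun n =>
    contDiff_finsum_aux _ (hχ n) (hχlf n)
  have hle : ∀ n a x, χ n a x ≤ g n x := fun n a x =>
    single_le_finsum a ((hχlf n).point_finite x) (fun j => hχ0 n j x)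
  have hg0 : ∀ n x, 0 ≤ g n x := fun n x => finsum_nonneg fun a => hχ0 n a x
  have hgpos : ∀ x, ∃ n, 0 < g n x := fun x => by
    obtain ⟨n, a, h⟩ := hχpos x
    exact ⟨n, h.trans_le (hle n a x)⟩
  have hgne : ∀ n x, 0 < g n x → ∃ a, 0 < χ n a x := by
    intro n x h
    by_contra hcon
    push Not at hcon
    have : g n x = 0 := by
      simp only [g]
      rw [← finsum_zero (α := A) (M := ℝ)]
      exact finsum_congr fun a => le_antisymm (hcon a) (hχ0 n a x)
    linarith
  let θ : ℕ → X → ℝ := fun n x => ∏ k ∈ Finset.range n,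
    Real.smoothTransition (1 - (n + 1) * g k x)
  have hθ : ∀ n, ContDiff ℝ (m : WithTop ℕ∞) (θ n) := by
    intro n
    apply contDiff_prod
    intro k _
    exact Real.smoothTransition.contDiff.comp (contDiff_const.sub (contDiff_const.mul (hg k)))
  have hθ0 : ∀ n x, 0 ≤ θ n x := fun n x =>
    Finset.prod_nonneg fun k _ => Real.smoothTransition.nonneg _
  let ρ : ℕ × A → X → ℝ := fun i x => χ i.1 i.2 x * θ i.1 x
  have hρ : ∀ i, ContDiff ℝ (m : WithTop ℕ∞) (ρ i) := fun i => (hχ _ _).mul (hθ _)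
  have hρ0 : ∀ i x, 0 ≤ ρ i x := fun i x => mul_nonneg (hχ0 _ _ _) (hθ0 _ _)
  have hρlf : LocallyFinite fun i => Function.support (ρ i) := by
    intro x
    obtain ⟨j, hj⟩ := hgpos x
    obtain ⟨N, hN⟩ := exists_nat_one_div_lt (half_pos hj)
    have hV0 : ∀ᶠ y in nhds x, g j x / 2 < g j y :=
      (hg j).continuous.continuousAt.eventually (lt_mem_nhds (half_lt_self hj))
    choose V hV hVf using fun n => hχlf n x
    let M := max N j + 1
    refine ⟨{y | g j x / 2 < g j y} ∩ ⋂ n ∈ Finset.range M, V n,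
      Filter.inter_mem hV0 ((Filter.biInter_finset_mem _).2 fun n _ => hV n), ?_⟩
    refine Set.Finite.subset ((Finset.range M).finite_toSet.biUnion
      fun n _ => ((hVf n).image fun a => (n, a))) ?_
    rintro ⟨n, a⟩ ⟨y, hy1, hy2, hy3⟩
    have hne : χ n a y ≠ 0 ∧ θ n y ≠ 0 := by
      simpa [ρ, not_or] using hy1
    have hn : n < M := by
      by_contra hn
      apply hne.2
      apply Finset.prod_eq_zero (i := j) (Finset.mem_range.2 (by omega))
      apply Real.smoothTransition.zero_of_nonpos
      have h2 : g j x / 2 < g j y := hy2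
      have h3 : (N : ℝ) ≤ n := by exact_mod_cast (by omega : N ≤ n)
      have h4 : (0:ℝ) < N + 1 := by positivity
      rw [div_lt_iff₀ h4] at hN
      nlinarith
    simp only [Set.mem_iUnion]
    refine ⟨n, by simpa using hn, a, ⟨y, hne.1, ?_⟩, rfl⟩
    simp only [Set.mem_iInter] at hy3
    exact hy3 n (by simpa using hn)
  let S : X → ℝ := fun x => ∑ᶠ i, ρ i x
  have hS : ContDiff ℝ (m : WithTop ℕ∞) S := contDiff_finsum_aux _ hρ hρlf
  have hρS : ∀ i x, ρ i x ≤ S x := fun i x =>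
    single_le_finsum i (hρlf.point_finite x) (fun j => hρ0 j x)
  have hSpos : ∀ x, 0 < S x := by
    intro x
    have hex := hgpos x
    obtain ⟨a, ha⟩ := hgne _ x (Nat.find_spec hex)
    refine lt_of_lt_of_le ?_ (hρS (Nat.find hex, a) x)
    refine mul_pos ha (Finset.prod_pos fun k hk => ?_)
    have := Nat.find_min hex (Finset.mem_range.1 hk)
    have h0 : g k x = 0 := le_antisymm (not_lt.1 this) (hg0 k x)
    apply Real.smoothTransition.pos_of_pos
    simp [h0]
  have hsupp : ∀ i, Function.support (fun x => ρ i x / S x) ⊆ Function.support (ρ i) := by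
    intro i x hx h
    exact hx (by simp [h])
  refine ⟨ℕ × A, fun i x => ρ i x / S x, ?_, ?_, ?_, ?_, ?_⟩
  · exact fun i => (hρ i).div hS fun x => (hSpos x).ne'
  · exact fun i x => ⟨div_nonneg (hρ0 i x) (hSpos x).le, div_le_one_of_le₀ (hρS i x) (hSpos x).le⟩
  · exact (hρlf.subset hsupp).closure
  · rintro ⟨n, a⟩
    obtain ⟨U, hU, h⟩ := hχsub n a
    refine ⟨U, hU, subset_trans (closure_mono ((hsupp _).trans ?_)) h⟩
    intro x hx h0
    exact hx (by simp [ρ, h0])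
  · intro x
    have hfin : (Function.support fun i => ρ i x).Finite := hρlf.point_finite x
    have h1 : HasSum (fun i => ρ i x) (S x) := by
      have := (summable_of_hasFiniteSupport (L := .unconditional _) hfin).hasSum
      rwa [tsum_eq_finsum hfin] at this
    have := h1.div_const (S x)
    rwa [div_self (hSpos x).ne'] at this

theorem clopen_gap {K : Type*} [TopologicalSpace K] (x : C(K, ℝ)) (s : ℝ) (h : ∀ t, x t ≠ s) :
    ∃ e : C(K, ℝ), (∀ t, s < x t → e t = 1) ∧ (∀ t, x t < s → e t = 0) := by
  classical
  refine ⟨⟨fun t => if s < x t then 1 else 0, ?_⟩, ?_, ?_⟩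
  · apply Continuous.if
    · intro t ht
      have hcl : IsClopen {t | s < x t} := by
        refine ⟨?_, isOpen_lt continuous_const x.continuous⟩
        have : {t | s < x t} = {t | s ≤ x t} := by
          ext t
          exact ⟨fun h : s < x t => (le_of_lt h : s ≤ x t),
            fun h' : s ≤ x t => (lt_of_le_of_ne h' (h t).symm : s < x t)⟩
        rw [this]
        exact isClosed_le continuous_const x.continuous
      rw [hcl.frontier_eq] at ht
      exact ht.elim
    · exact continuous_const
    · exact continuous_const
  · intro t ht; simp [ht]
  · intro t ht; simp [ht.le]

theorem cexp_apply {K : Type*} [TopologicalSpace K] [CompactSpace K] (f : C(K, ℝ)) (t : K) :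
    (NormedSpace.exp f) t = Real.exp (f t) := by
  have := NormedSpace.map_exp (𝔸 := C(K, ℝ)) (𝔹 := ℝ) (ContinuousMap.evalAlgHom ℝ ℝ t)
    (by exact continuous_eval_const t) f
  rw [Real.exp_eq_exp_ℝ]
  exact this

theorem cexp_contDiff {K : Type*} [TopologicalSpace K] [CompactSpace K] (m : ℕ∞) :
    ContDiff ℝ (m : WithTop ℕ∞) (NormedSpace.exp : C(K, ℝ) → C(K, ℝ)) := by
  have : AnalyticOnNhd ℝ (NormedSpace.exp : C(K, ℝ) → C(K, ℝ)) Set.univ :=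
    fun x _ => NormedSpace.exp_analytic x
  exact this.contDiff

noncomputable def pwH {K : Type*} [TopologicalSpace K] [CompactSpace K]
    (S : Finset ℚ) (η : ℚ) (l : ℕ) (p : ℚ → C(K, ℝ)) (f : C(K, ℝ)) : C(K, ℝ) :=
  ∑ s ∈ S, (p s * NormedSpace.exp ((l : ℝ) • (ContinuousMap.const K ((s : ℝ) + η) - f)) +
    (1 - p s) * NormedSpace.exp ((l : ℝ) • (f - ContinuousMap.const K ((s : ℝ) - η))))

theorem pwH_apply {K : Type*} [TopologicalSpace K] [CompactSpace K]
    (S : Finset ℚ) (η : ℚ) (l : ℕ) (p : ℚ → C(K, ℝ)) (f : C(K, ℝ)) (t : K) :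
    pwH S η l p f t = ∑ s ∈ S, (p s t * Real.exp (l * ((s + η) - f t)) +
      (1 - p s t) * Real.exp (l * (f t - (s - η)))) := by
  simp [pwH, ContinuousMap.sum_apply, cexp_apply]

theorem pwH_contDiff {K : Type*} [TopologicalSpace K] [CompactSpace K] (m : ℕ∞)
    (S : Finset ℚ) (η : ℚ) (l : ℕ) (p : ℚ → C(K, ℝ)) :
    ContDiff ℝ (m : WithTop ℕ∞) (pwH S η l p) := by
  unfold pwH
  apply ContDiff.sum
  intro s _
  apply ContDiff.add
  · exact contDiff_const.mul ((cexp_contDiff m).comp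
      ((contDiff_const.sub contDiff_id).const_smul _))
  · exact contDiff_const.mul ((cexp_contDiff m).comp
      ((contDiff_id.sub contDiff_const).const_smul _))

def PwValid {K : Type*} [TopologicalSpace K] (S : Finset ℚ) (p : ℚ → C(K, ℝ)) : Prop :=
  (∀ s t, p s t = 0 ∨ p s t = 1) ∧ ∀ s ∉ S, p s = 0

theorem pwH_sep {K : Type*} [TopologicalSpace K] [CompactSpace K]
    (S : Finset ℚ) (η : ℚ) (l : ℕ) (p : ℚ → C(K, ℝ)) (hp : PwValid S p) (f : C(K, ℝ))
    (h : ‖pwH S η l p f‖ < 1) (s : ℚ) (hs : s ∈ S) (t : K) :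
    (p s t = 1 → s + η < f t) ∧ (p s t = 0 → f t < s - η) := by
  have h1 : pwH S η l p f t < 1 :=
    (le_abs_self _).trans_lt (((pwH S η l p f).norm_coe_le_norm t).trans_lt h)
  rw [pwH_apply] at h1
  have h2 := Finset.single_le_sum (s := S) (f := fun s => (p s t * Real.exp (l * ((s + η) - f t)) +
      (1 - p s t) * Real.exp (l * (f t - (s - η))))) (fun r _ => by
        rcases hp.1 r t with h | h <;> simp [h] <;> positivity) hs
  have h3 := h2.trans_lt h1
  have hl : (0:ℝ) ≤ l := by positivity
  constructor
  · intro h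
    simp only [h, one_mul, sub_self, zero_mul, add_zero, Real.exp_lt_one_iff] at h3
    by_contra hc
    have : 0 ≤ (l:ℝ) * ((s + η) - f t) := mul_nonneg hl (by linarith)
    linarith
  · intro h
    simp only [h, one_mul, sub_zero, zero_mul, zero_add, Real.exp_lt_one_iff] at h3
    by_contra hc
    have : 0 ≤ (l:ℝ) * (f t - (s - η)) := mul_nonneg hl (by linarith)
    linarith

theorem pu_main (K : Type u) [TopologicalSpace K] [CompactSpace K]
    (m : ℕ∞) (φ : C(K, ℝ) → ℝ) (hφ : ContDiff ℝ (m : WithTop ℕ∞) φ) (hm : 1 ≤ m)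
    (h0 : 0 < φ 0) (hnn : ∀ g, 0 ≤ φ g)
    (h1 : ∀ g, 1 ≤ ‖g‖ → φ g = 0) : AdmitsPartitionsOfUnity C(K, ℝ) m := by
  classical
  have hφ1 : ContDiff ℝ 1 φ := hφ.of_le (by exact_mod_cast hm)
  obtain ⟨dec, hdec⟩ := exists_surjective_nat (Finset ℚ × ℚ × ℕ)
  let Ψ : (Finset ℚ × ℚ × ℕ) → (ℚ → C(K, ℝ)) → C(K, ℝ) → ℝ := fun D p =>
    if PwValid D.1 p ∧ 0 < D.2.1 then fun f => φ (pwH D.1 D.2.1 D.2.2 p f) else fun _ => 0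
  have hsep : ∀ D p f, Ψ D p f ≠ 0 → PwValid D.1 p ∧ 0 < D.2.1 ∧ ∀ s ∈ D.1, ∀ t,
      (p s t = 1 → s + D.2.1 < f t) ∧ (p s t = 0 → f t < s - D.2.1) := by
    intro D p f h
    simp only [Ψ] at h
    split_ifs at h with hv
    · refine ⟨hv.1, hv.2, fun s hs t => pwH_sep D.1 D.2.1 D.2.2 p hv.1 f ?_ s hs t⟩
      by_contra hc
      exact h (h1 _ (not_lt.1 hc))
    · exact absurd rfl h
  refine pu_of_base m (fun n => Ψ (dec n)) ?_ ?_ ?_ ?_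
  · intro n p
    simp only [Ψ]
    split_ifs
    · exact hφ.comp (pwH_contDiff m _ _ _ _)
    · exact contDiff_const
  · intro n p x
    simp only [Ψ]
    split_ifs
    · exact hnn _
    · exact le_rfl
  · intro n x
    set D := dec n
    by_cases hη : 0 < D.2.1
    · have hη' : (0:ℝ) < D.2.1 := by exact_mod_cast hη
      refine ⟨Metric.ball x D.2.1, Metric.ball_mem_nhds _ hη', Set.Subsingleton.finite ?_⟩
      rintro p ⟨f, hf, hfx⟩ q ⟨g, hg, hgx⟩
      obtain ⟨hp, -, hps⟩ := hsep D p f hf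
      obtain ⟨hq, -, hqs⟩ := hsep D q g hg
      funext s
      by_cases hs : s ∈ D.1
      · ext t
        have hf1 := (abs_lt.1 ((ContinuousMap.dist_apply_le_dist t).trans_lt hfx))
        have hg1 := (abs_lt.1 ((ContinuousMap.dist_apply_le_dist t).trans_lt hgx))
        have hp1 := hps s hs t
        have hq1 := hqs s hs t
        rcases hp.1 s t with h | h <;> rcases hq.1 s t with h' | h'
        · rw [h, h']
        · have := hp1.2 h
          have := hq1.1 h'
          linarith [hf1.1, hf1.2, hg1.1, hg1.2]
        · have := hp1.1 h
          have := hq1.2 h'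
          linarith [hf1.1, hf1.2, hg1.1, hg1.2]
        · rw [h, h']
      · rw [hp.2 s hs, hq.2 s hs]
    · refine ⟨Set.univ, Filter.univ_mem, Set.Finite.subset Set.finite_empty ?_⟩
      rintro p ⟨f, hf, -⟩
      exact hη (hsep D p f hf).2.1
  · intro x ε hε
    -- choose S
    have hST : ∃ S : Finset ℚ, (∀ s ∈ S, ∀ t, x t ≠ s) ∧
        ∀ t, ∃ s ∈ S, ∃ s' ∈ S, (s:ℝ) < x t ∧ x t < s' ∧ (s' : ℝ) - s < ε / 2 := by
      have hq : ∀ t, ∃ s s' : ℚ, (∀ u, x u ≠ s) ∧ (∀ u, x u ≠ s') ∧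
          (s:ℝ) < x t ∧ x t < s' ∧ (s' : ℝ) - s < ε / 2 := by
        intro t
        obtain ⟨s, h2, h3, h4⟩ := gap_rat φ hφ1 h0 h1 x (x t - ε/4) (x t) (by linarith)
        obtain ⟨s', h5, h6, h7⟩ := gap_rat φ hφ1 h0 h1 x (x t) (x t + ε/4) (by linarith)
        exact ⟨s, s', h4, h7, h3, h5, by linarith⟩
      choose a b ha hb hax hxb hab using hq
      obtain ⟨T, hT⟩ := isCompact_univ.elim_nhds_subcover
        (fun t => {u | (a t : ℝ) < x u} ∩ {u | x u < b t}) (fun t _ =>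
          ((isOpen_lt continuous_const x.continuous).inter
            (isOpen_lt x.continuous continuous_const)).mem_nhds ⟨hax t, hxb t⟩)
      refine ⟨T.image a ∪ T.image b, ?_, ?_⟩
      · intro s hs
        rcases Finset.mem_union.1 hs with hs | hs
        · obtain ⟨t, -, rfl⟩ := Finset.mem_image.1 hs
          exact ha t
        · obtain ⟨t, -, rfl⟩ := Finset.mem_image.1 hs
          exact hb t
      · intro u
        obtain ⟨t, ht, hu⟩ := Set.mem_iUnion₂.1 (hT.2 (Set.mem_univ u))
        exact ⟨a t, Finset.mem_union_left _ (Finset.mem_image_of_mem _ ht), b t,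
          Finset.mem_union_right _ (Finset.mem_image_of_mem _ ht), hu.1, hu.2, hab t⟩
    obtain ⟨S, hS, hSt⟩ := hST
    have hηex : ∃ η : ℚ, 0 < η ∧ ∀ s ∈ S, ∀ t, 2 * (η : ℝ) < |x t - s| := by
      have hfin : ((fun q : ℚ => (q : ℝ)) '' (S : Set ℚ)).Finite := S.finite_toSet.image _
      obtain ⟨δ, hδ, hsub⟩ := hfin.isCompact.exists_thickening_subset_open
        (isCompact_range x.continuous).isClosed.isOpen_compl (by
          rintro _ ⟨s, hs, rfl⟩ ⟨t, ht⟩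
          exact hS s hs t ht)
      obtain ⟨η, hη1, hη2⟩ := exists_rat_btwn (show (0:ℝ) < δ / 2 by positivity)
      refine ⟨η, by exact_mod_cast hη1, fun s hs t => ?_⟩
      by_contra hc
      refine hsub (Metric.mem_thickening_iff.2 ⟨s, ⟨s, hs, rfl⟩, ?_⟩) ⟨t, rfl⟩
      rw [Real.dist_eq]
      linarith
    obtain ⟨η, hη, hηS⟩ := hηex
    have hη' : (0:ℝ) < η := by exact_mod_cast hη
    obtain ⟨r, hr, hrφ⟩ := Metric.eventually_nhds_iff.1
      (hφ.continuous.continuousAt.eventually (lt_mem_nhds h0))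
    obtain ⟨l, hl⟩ : ∃ l : ℕ, (S.card : ℝ) * Real.exp (-(l * η)) < r := by
      have h2 : Filter.Tendsto (fun l : ℕ => (S.card : ℝ) * Real.exp (-(l * η)))
          Filter.atTop (nhds (S.card * 0)) := by
        apply Filter.Tendsto.const_mul
        apply Real.tendsto_exp_neg_atTop_nhds_zero.comp
        exact tendsto_natCast_atTop_atTop.atTop_mul_const hη'
      rw [mul_zero] at h2
      exact (h2.eventually (gt_mem_nhds hr)).exists
    have hpex : ∀ s : ℚ, ∃ e : C(K, ℝ), (s ∈ S → (∀ t, s < x t → e t = 1) ∧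
        (∀ t, x t < s → e t = 0)) ∧ (s ∉ S → e = 0) := by
      intro s
      by_cases hs : s ∈ S
      · obtain ⟨e, he⟩ := clopen_gap x s (hS s hs)
        exact ⟨e, fun _ => he, fun h => absurd hs h⟩
      · exact ⟨0, fun h => absurd h hs, fun _ => rfl⟩
    choose p hp1 hp2 using hpex
    have hval : PwValid S p := by
      refine ⟨fun s t => ?_, hp2⟩
      by_cases hs : s ∈ S
      · rcases lt_or_gt_of_ne (hS s hs t) with h | h
        · exact Or.inl ((hp1 s hs).2 t h)
        · exact Or.inr ((hp1 s hs).1 t h)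
      · left; rw [hp2 s hs]; rfl
    obtain ⟨n, hn⟩ := hdec (S, η, l)
    refine ⟨n, p, ?_, ?_⟩
    · simp only [hn, Ψ]
      rw [if_pos ⟨hval, hη⟩]
      apply hrφ
      rw [dist_zero_right, ContinuousMap.norm_lt_iff _ hr]
      intro t
      rw [pwH_apply]
      refine lt_of_le_of_lt ?_ hl
      refine (norm_sum_le _ _).trans ?_
      rw [← nsmul_eq_mul]
      apply Finset.sum_le_card_nsmul
      intro s hs
      have h3 := hηS s hs t
      rcases lt_or_gt_of_ne (hS s hs t) with h | h
      · rw [(hp1 s hs).2 t h]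
        rw [abs_of_neg (by linarith)] at h3
        simp only [zero_mul, zero_add, sub_zero, one_mul, Real.norm_eq_abs, Real.abs_exp,
          Real.exp_le_exp]
        rw [← mul_neg]
        gcongr
        linarith
      · rw [(hp1 s hs).1 t h]
        rw [abs_of_pos (by linarith)] at h3
        simp only [zero_mul, add_zero, sub_self, one_mul, Real.norm_eq_abs, Real.abs_exp,
          Real.exp_le_exp]
        rw [← mul_neg]
        gcongr
        linarith
    · have hsub : Function.support (Ψ (dec n) p) ⊆ Metric.closedBall x (ε/2) := by
        intro g hg
        rw [hn] at hg
        obtain ⟨-, -, hgs⟩ := hsep _ p g hg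
        rw [Metric.mem_closedBall, ContinuousMap.dist_le (by positivity)]
        intro t
        obtain ⟨s, hs, s', hs', h3, h4, h5⟩ := hSt t
        have h6 := (hgs s hs t).1 ((hp1 s hs).1 t h3)
        have h7 := (hgs s' hs' t).2 ((hp1 s' hs').2 t h4)
        simp only at h6 h7
        rw [Real.dist_eq, abs_le]
        constructor <;> linarith
      exact (closure_minimal hsub Metric.isClosed_closedBall).trans
        (Metric.closedBall_subset_ball (by linarith))

theorem pu_zero (X : Type u) [NormedAddCommGroup X] [NormedSpace ℝ X] :
    AdmitsPartitionsOfUnity X 0 := by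
  intro 𝒰 hopen hcov
  obtain ⟨f, hf⟩ := PartitionOfUnity.exists_isSubordinate (X := X) (s := Set.univ) isClosed_univ
    (fun U : 𝒰 => (U : Set X)) (fun U => hopen U U.2) (by rw [← Set.sUnion_eq_iUnion, hcov])
  refine ⟨𝒰, fun i => f i, ?_, ?_, ?_, ?_, ?_⟩
  · intro i
    simpa using (contDiff_zero (𝕜 := ℝ)).2 (f i).continuous
  · exact fun i x => ⟨f.nonneg i x, f.le_one i x⟩
  · exact f.locallyFinite.closure
  · exact fun i => ⟨i, i.2, hf i⟩
  · intro x
    have hfin : (Function.support fun i => f i x).Finite := f.locallyFinite.point_finite x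
    have := (summable_of_hasFiniteSupport (L := .unconditional _) hfin).hasSum
    rwa [tsum_eq_finsum hfin, f.sum_eq_one (Set.mem_univ x)] at this

theorem stmt_8 (K : Type u) [TopologicalSpace K] [CompactSpace K] [T2Space K]
    (m : ℕ∞) (hbump : ∃ b : C(K, ℝ) → ℝ, IsBumpOfClass m b) :
    AdmitsPartitionsOfUnity C(K, ℝ) m := by
  rcases eq_or_ne m 0 with rfl | hm
  · exact pu_zero _
  obtain ⟨b, hb, ⟨x0, hx0⟩, s, hs, hbs⟩ := hbump
  obtain ⟨R, hR0, hR⟩ := hs.exists_pos_norm_le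
  let c : ℝ := R + ‖x0‖ + 1
  have hc : 0 < c := by positivity
  refine pu_main K m (fun g => b (x0 + c • g) ^ 2) ?_ (Order.one_le_iff_ne_zero.2 hm) ?_ ?_ ?_
  · exact (hb.comp (contDiff_const.add (contDiff_id.const_smul c))).pow 2
  · simp only [smul_zero, add_zero]; positivity
  · intro g; positivity
  · intro g hg
    have : x0 + c • g ∉ s := by
      intro h
      have h2 := hR _ h
      have h3 := norm_sub_le (x0 + c • g) x0
      rw [add_sub_cancel_left, norm_smul, Real.norm_of_nonneg hc.le] at h3
      have : c ≤ c * ‖g‖ := le_mul_of_one_le_right hc.le hg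
      simp only [c] at *
      linarith
    simp [hbs _ this]
end

section
/- Let K be a compact Hausdorff space which is σ-discrete, i.e. K = ⋃_{i∈ℕ} D_i where the D_i are pairwise disjoint and each D_i is discrete in its subspace topology (equivalently D_i ∩ D_i' = ∅, where D_i' is the derived set of D_i). Then C(K) admits an equivalent norm which is of class C^∞ on C(K) \ {0}. -/
open Set Filter Topology

theorem aux_phi : ∃ Φ : ℝ → ℝ, ContDiff ℝ ((⊤ : ℕ∞) : WithTop ℕ∞) Φ ∧ ConvexOn ℝ univ Φ ∧
    (∀ x, Φ (-x) = Φ x) ∧ (∀ x, 0 ≤ Φ x) ∧ (∀ x, |x| ≤ 1 → Φ x = 0) ∧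
    (∀ a x, 1 < a → a ≤ |x| → 0 < Φ a ∧ Φ a ≤ Φ x) := by
  let φ : ℝ → ℝ := fun x => x * expNegInvGlue x
  have hφ0 : ∀ x ≤ 0, φ x = 0 := fun x hx => by simp [φ, expNegInvGlue.zero_of_nonpos hx]
  have hφn : ∀ x, 0 ≤ φ x := by
    intro x
    rcases le_total x 0 with h | h
    · rw [hφ0 x h]
    · exact mul_nonneg h (expNegInvGlue.nonneg x)
  have hφm : Monotone φ := by
    intro x y hxy
    rcases le_total x 0 with h | h
    · rw [hφ0 x h]; exact hφn y
    · exact mul_le_mul hxy (expNegInvGlue.monotone hxy) (expNegInvGlue.nonneg x) (h.trans hxy)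
  have hφp : ∀ x, 0 < x → 0 < φ x := fun x hx => mul_pos hx (expNegInvGlue.pos_of_pos hx)
  have hφpos : ∀ x, 0 < x → φ x = x * Real.exp (-x⁻¹) := by
    intro x hx
    simp [φ, expNegInvGlue, not_le.2 hx]
  have key : ∀ x y a b : ℝ, 0 < x → 0 < a → 0 < b → a + b = 1 →
      φ (a * x + b * y) ≤ a * φ x + b * φ y := by
    intro x y a b hx ha hb hab
    rcases le_or_gt y 0 with hy | hy
    · rw [hφ0 y hy]
      have h1 : φ (a * x + b * y) ≤ φ (a * x) := hφm (by nlinarith)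
      have h2 : φ (a * x) ≤ a * φ x := by
        simp only [φ]
        rw [mul_assoc]
        have : expNegInvGlue (a * x) ≤ expNegInvGlue x := expNegInvGlue.monotone (by nlinarith)
        gcongr
      linarith
    · have hz : 0 < a * x + b * y := by positivity
      rw [hφpos _ hz, hφpos x hx, hφpos y hy]
      set z := a * x + b * y with hzdef
      have hc := convexOn_exp.2 (mem_univ (-x⁻¹)) (mem_univ (-y⁻¹))
        (show 0 ≤ a * x / z by positivity) (show 0 ≤ b * y / z by positivity)
        (by rw [← add_div, ← hzdef, div_self hz.ne'])
      have he : (a * x / z) • (-x⁻¹) + (b * y / z) • (-y⁻¹) = -z⁻¹ := by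
        simp only [smul_eq_mul]
        have : a = 1 - b := by linarith
        field_simp
        linarith
      rw [he] at hc
      simp only [smul_eq_mul] at hc
      calc z * Real.exp (-z⁻¹) ≤ z * (a * x / z * Real.exp (-x⁻¹) + b * y / z * Real.exp (-y⁻¹)) := by
            gcongr
        _ = _ := by field_simp
  have hφc : ConvexOn ℝ univ φ := by
    rw [convexOn_iff_forall_pos]
    refine ⟨convex_univ, ?_⟩
    intro x _ y _ a b ha hb hab
    simp only [smul_eq_mul]
    rcases le_or_gt x 0 with hx | hx
    · rcases le_or_gt y 0 with hy | hy
      · rw [hφ0 x hx, hφ0 y hy, hφ0 _ (by nlinarith)]; simp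
      · have := key y x b a hy hb ha (by linarith)
        rw [add_comm (a * x), add_comm (a * φ x)]; exact this
    · exact key x y a b hx ha hb hab
  have hφd : ContDiff ℝ ((⊤ : ℕ∞) : WithTop ℕ∞) φ := contDiff_id.mul expNegInvGlue.contDiff
  refine ⟨fun x => φ (x - 1) + φ (-x - 1), ?_, ?_, ?_, ?_, ?_, ?_⟩
  · exact (hφd.comp (contDiff_id.sub contDiff_const)).add
      (hφd.comp (contDiff_id.neg.sub contDiff_const))
  · refine ⟨convex_univ, ?_⟩
    intro x _ y _ a b ha hb hab
    have h1 := hφc.2 (mem_univ (x - 1)) (mem_univ (y - 1)) ha hb hab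
    have h2 := hφc.2 (mem_univ (-x - 1)) (mem_univ (-y - 1)) ha hb hab
    simp only [smul_eq_mul] at *
    have e1 : a * (x - 1) + b * (y - 1) = a * x + b * y - 1 := by
      have : a = 1 - b := by linarith
      subst this; ring
    have e2 : a * (-x - 1) + b * (-y - 1) = -(a * x + b * y) - 1 := by
      have : a = 1 - b := by linarith
      subst this; ring
    rw [e1] at h1
    rw [e2] at h2
    linarith
  · intro x
    simp only [neg_neg]
    ring
  · intro x
    exact add_nonneg (hφn _) (hφn _)
  · intro x hx
    have := abs_le.1 hx
    show φ (x - 1) + φ (-x - 1) = 0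
    rw [hφ0 _ (by linarith), hφ0 _ (by linarith)]; simp
  · intro a x ha hx
    show 0 < φ (a - 1) + φ (-a - 1) ∧ φ (a - 1) + φ (-a - 1) ≤ φ (x - 1) + φ (-x - 1)
    rw [hφ0 (-a - 1) (by linarith), add_zero]
    refine ⟨hφp _ (by linarith), ?_⟩
    rcases le_abs.1 hx with h | h
    · have := hφm (show a - 1 ≤ x - 1 by linarith)
      linarith [hφn (-x - 1)]
    · have := hφm (show a - 1 ≤ -x - 1 by linarith)
      linarith [hφn (x - 1)]

theorem aux_weights {K : Type*} [TopologicalSpace K] [T2Space K]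
    (D : ℕ → Set K) (hcover : ⋃ i, D i = Set.univ)
    (hdiscr : ∀ i, D i ∩ derivedSet (D i) = ∅) :
    ∃ W V : K → ℝ, ∀ t, 1 ≤ V t ∧ V t < W t ∧ W t ≤ 2 ∧
      ∃ m < V t, ∀ᶠ s in 𝓝[≠] t, W s ≤ m := by
  classical
  let g : K → ℕ → ℝ := fun t i => (closure (D i)).indicator (fun _ => (1 / 2 : ℝ) / 2 ^ i) t
  have hg0 : ∀ t i, 0 ≤ g t i := fun t i => indicator_nonneg (fun _ _ => by positivity) _
  have hg1 : ∀ t i, g t i ≤ (1 / 2 : ℝ) / 2 ^ i := fun t i =>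
    indicator_le_self' (f := fun _ => (1 / 2 : ℝ) / 2 ^ i) (fun _ _ => by positivity) t
  have hs : Summable (fun i : ℕ => (1 / 2 : ℝ) / 2 ^ i) := by
    have := summable_geometric_two' (1 : ℝ)
    simpa using this
  have hsum1 : ∑' i : ℕ, (1 / 2 : ℝ) / 2 ^ i = 1 := by
    have := tsum_geometric_two' (1 : ℝ)
    simpa using this
  have hgs : ∀ t, Summable (g t) := fun t => Summable.of_nonneg_of_le (hg0 t) (hg1 t) hs
  have hj : ∀ t : K, ∃ j, t ∈ D j := fun t => by
    have : t ∈ ⋃ i, D i := hcover ▸ mem_univ t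
    simpa using this
  choose j hj using hj
  let W : K → ℝ := fun t => 1 + ∑' i, g t i
  have hgj : ∀ t, g t (j t) = (1 / 2 : ℝ) / 2 ^ (j t) := fun t =>
    indicator_of_mem (subset_closure (hj t)) _
  refine ⟨W, fun t => W t - (1 / 4) / 2 ^ (j t), fun t => ⟨?_, ?_, ?_, ?_⟩⟩
  · have : g t (j t) ≤ ∑' i, g t i := (hgs t).le_tsum _ (fun i _ => hg0 t i)
    rw [hgj] at this
    have h2 : (1 / 4 : ℝ) / 2 ^ (j t) ≤ (1 / 2) / 2 ^ (j t) := by gcongr; norm_num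
    simp only [W]; linarith
  · have : (0 : ℝ) < (1 / 4) / 2 ^ (j t) := by positivity
    linarith
  · have : ∑' i, g t i ≤ ∑' i : ℕ, (1 / 2 : ℝ) / 2 ^ i := (hgs t).tsum_le_tsum (hg1 t) hs
    simp only [W]; linarith
  · refine ⟨W t - (3 / 8) / 2 ^ (j t), ?_, ?_⟩
    · have : (1 / 4 : ℝ) / 2 ^ (j t) < (3 / 8) / 2 ^ (j t) := div_lt_div_of_pos_right (by norm_num) (by positivity)
      linarith
    set J := j t with hJ
    have hA : ∀ᶠ s in 𝓝[≠] t, ∀ i ∈ Finset.range (J + 3), s ∈ closure (D i) → t ∈ closure (D i) := by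
      rw [Filter.eventually_all_finset]
      intro i _
      by_cases h : t ∈ closure (D i)
      · exact Eventually.of_forall fun s _ => h
      · have : ∀ᶠ s in 𝓝 t, s ∈ (closure (D i))ᶜ := isClosed_closure.isOpen_compl.mem_nhds h
        filter_upwards [nhdsWithin_le_nhds this] with s hs h'
        exact absurd h' hs
    have hB : ∀ᶠ s in 𝓝[≠] t, s ∉ closure (D J) := by
      have h1 : t ∉ derivedSet (D J) := fun h => by
        have : t ∈ D J ∩ derivedSet (D J) := ⟨hj t, h⟩
        rw [hdiscr] at this; exact this
      rw [mem_derivedSet, accPt_iff_frequently_nhdsNE, not_frequently] at h1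
      have h2 := eventually_eventually_nhdsWithin.2 h1
      filter_upwards [h2, self_mem_nhdsWithin] with s hs hst
      have hs' : ∀ᶠ x in 𝓝 s, x ∉ D J := by
        have : 𝓝[≠] t = 𝓝[≠] t := rfl
        have h3 : 𝓝[{t}ᶜ] s = 𝓝 s := isOpen_compl_singleton.nhdsWithin_eq hst
        rwa [h3] at hs
      rw [mem_closure_iff_frequently]
      exact fun h => h hs'
    filter_upwards [hA, hB] with s hsA hsB
    have e1 := (hgs s).sum_add_tsum_nat_add (J + 3)
    have e2 := (hgs t).sum_add_tsum_nat_add (J + 3)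
    have e3 : ∑' i, g s (i + (J + 3)) ≤ (1 / 8) / 2 ^ J := by
      have hs' : ∀ i : ℕ, (1 / 2 : ℝ) / 2 ^ (i + (J + 3)) = ((1 / 8) / 2 ^ J) * ((1 / 2) / 2 ^ i) := by
        intro i
        rw [pow_add, pow_add]; field_simp; norm_num
      calc ∑' i, g s (i + (J + 3)) ≤ ∑' i : ℕ, ((1 / 8 : ℝ) / 2 ^ J) * ((1 / 2) / 2 ^ i) := by
            refine Summable.tsum_le_tsum (fun i => ?_) ((summable_nat_add_iff (J + 3)).2 (hgs s))
              (hs.mul_left _)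
            rw [← hs']; exact hg1 s _
        _ = _ := by rw [tsum_mul_left, hsum1, mul_one]
    have e4 : 0 ≤ ∑' i, g t (i + (J + 3)) := tsum_nonneg fun i => hg0 t _
    have e5 : ∑ i ∈ Finset.range (J + 3), g s i + (1 / 2) / 2 ^ J
        ≤ ∑ i ∈ Finset.range (J + 3), g t i := by
      have hJm : J ∈ Finset.range (J + 3) := by simp
      rw [← Finset.add_sum_erase _ _ hJm, ← Finset.add_sum_erase _ (g t) hJm]
      have h0 : g s J = 0 := indicator_of_notMem hsB _
      have h1 : g t J = (1 / 2) / 2 ^ J := hgj t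
      have h2 : ∑ i ∈ (Finset.range (J + 3)).erase J, g s i
          ≤ ∑ i ∈ (Finset.range (J + 3)).erase J, g t i := by
        refine Finset.sum_le_sum fun i hi => ?_
        by_cases h : s ∈ closure (D i)
        · have h' := hsA i (Finset.mem_of_mem_erase hi) h
          simp [g, h, h']
        · have : g s i = 0 := indicator_of_notMem h _
          rw [this]; exact hg0 t i
      linarith
    have e6 : (3 / 8 : ℝ) / 2 ^ J = (1 / 2) / 2 ^ J - (1 / 8) / 2 ^ J := by ring
    simp only [W]
    linarith

theorem aux_main (K : Type*) [TopologicalSpace K] [CompactSpace K]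
    (Ψ : K → ℝ → ℝ) (W V : K → ℝ)
    (hd : ∀ t, ContDiff ℝ ((⊤ : ℕ∞) : WithTop ℕ∞) (Ψ t))
    (hc : ∀ t, ConvexOn ℝ univ (Ψ t))
    (he : ∀ t x, Ψ t (-x) = Ψ t x) (hn : ∀ t x, 0 ≤ Ψ t x)
    (hz : ∀ t x, W t * |x| ≤ 1 → Ψ t x = 0)
    (h1 : ∀ t x, Ψ t x ≤ 1 → V t * |x| ≤ 1)
    (hV : ∀ t, 1 ≤ V t) (hW0 : ∀ t, 0 ≤ W t) (hW : ∀ t, W t ≤ 2)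
    (hWV : ∀ t, ∃ m < V t, ∀ᶠ s in 𝓝[≠] t, W s ≤ m) :
    ∃ N : C(K, ℝ) → ℝ,
      (∀ f g : C(K, ℝ), N (f + g) ≤ N f + N g) ∧
      (∀ (a : ℝ) (f : C(K, ℝ)), N (a • f) = |a| * N f) ∧
      (∀ f : C(K, ℝ), N f = 0 ↔ f = 0) ∧
      (∃ c C : ℝ, 0 < c ∧ 0 < C ∧ ∀ f : C(K, ℝ), c * ‖f‖ ≤ N f ∧ N f ≤ C * ‖f‖) ∧
      ContDiffOn ℝ ((⊤ : ℕ∞) : WithTop ℕ∞) N {f : C(K, ℝ) | f ≠ 0} := by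
  classical
  have hΨ0 : ∀ t, Ψ t 0 = 0 := fun t => hz t 0 (by simp)
  let H : Finset K → C(K, ℝ) → ℝ := fun F f => ∑ t ∈ F, Ψ t (f t)
  have hHc : ∀ F, ConvexOn ℝ univ (H F) := by
    intro F
    refine ⟨convex_univ, ?_⟩
    intro f _ g _ a b ha hb hab
    simp only [H, smul_eq_mul, Finset.mul_sum]
    rw [← Finset.sum_add_distrib]
    refine Finset.sum_le_sum fun t _ => ?_
    simpa using (hc t).2 (mem_univ (f t)) (mem_univ (g t)) ha hb hab
  have hH0 : ∀ F, H F 0 = 0 := fun F => by simp [H, hΨ0]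
  let B : Set C(K, ℝ) := {f | ∀ F, H F f ≤ 1}
  have hBc : Convex ℝ B := by
    intro f hf g hg a b ha hb hab F
    have := (hHc F).2 (mem_univ f) (mem_univ g) ha hb hab
    have h2 := hf F
    have h3 := hg F
    simp only [smul_eq_mul] at this
    nlinarith
  have hBsymm : ∀ f ∈ B, -f ∈ B := by
    intro f hf F
    have : H F (-f) = H F f := by simp [H, he]
    rw [this]; exact hf F
  have hball : Metric.ball (0 : C(K, ℝ)) (1 / 2) ⊆ B := by
    intro f hf F
    rw [mem_ball_zero_iff] at hf
    have : H F f = 0 := Finset.sum_eq_zero fun t _ => hz t _ (by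
      have h2 := f.norm_coe_le_norm t
      rw [Real.norm_eq_abs] at h2
      have := hW t; have := hW0 t; have := abs_nonneg (f t)
      nlinarith)
    rw [this]; norm_num
  have hBn : B ∈ 𝓝 (0 : C(K, ℝ)) := mem_of_superset (Metric.ball_mem_nhds _ (by norm_num)) hball
  have habs : Absorbent ℝ B := absorbent_nhds_zero hBn
  have hB1 : ∀ f ∈ B, ∀ t, V t * |f t| ≤ 1 := by
    intro f hf t
    have := hf {t}
    simp only [H, Finset.sum_singleton] at this
    exact h1 t _ this
  have hBcb : B ⊆ Metric.closedBall 0 1 := by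
    intro f hf
    rw [mem_closedBall_zero_iff, ContinuousMap.norm_le _ zero_le_one]
    intro t
    have := hB1 f hf t
    have := hV t
    rw [Real.norm_eq_abs]
    nlinarith [abs_nonneg (f t)]
  -- elements below the gauge
  have hmem : ∀ (f : C(K, ℝ)) (u : ℝ), 0 < u → u * gauge B f < 1 → u • f ∈ B := by
    intro f u hu h
    have h0 : (0 : C(K, ℝ)) ∈ B := mem_of_mem_nhds hBn
    apply setOfPred_gauge_lt_one_subset_self hBc h0 habs
    show gauge B (u • f) < 1
    rw [gauge_smul_of_nonneg hu.le]; simpa using h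
  have hgle : ∀ (f : C(K, ℝ)) (u : ℝ), 0 < u → u • f ∈ B → u * gauge B f ≤ 1 := by
    intro f u hu h
    have := gauge_le_one_of_mem h
    rw [gauge_smul_of_nonneg hu.le] at this; simpa using this
  have hlow : ∀ f : C(K, ℝ), ‖f‖ ≤ gauge B f := fun f => by
    have := le_gauge_of_subset_closedBall (x := f) habs zero_le_one hBcb
    simpa using this
  have hup : ∀ f : C(K, ℝ), gauge B f ≤ 2 * ‖f‖ := fun f => by
    have := mul_gauge_le_norm (x := f) hball
    linarith
  have hVle : ∀ (f : C(K, ℝ)) t, V t * |f t| ≤ gauge B f := by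
    intro f t
    by_contra! h
    have hp : 0 ≤ gauge B f := gauge_nonneg f
    obtain ⟨r, hr1, hr2⟩ := exists_between h
    have hr : 0 < r := lt_of_le_of_lt hp hr1
    have := hB1 _ (hmem f r⁻¹ (by positivity) (by rw [inv_mul_lt_iff₀ hr]; linarith)) t
    simp only [ContinuousMap.smul_apply, smul_eq_mul, abs_mul, abs_of_pos (inv_pos.2 hr)] at this
    rw [mul_left_comm, inv_mul_le_iff₀ hr] at this
    linarith
  have hsub : ∀ (F : Finset K) (f : C(K, ℝ)), (∀ t ∉ F, W t * |f t| ≤ 1) → H F f ≤ 1 → f ∈ B := by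
    intro F f hF h F'
    refine le_trans ?_ h
    calc H F' f ≤ H (F' ∪ F) f :=
          Finset.sum_le_sum_of_subset_of_nonneg Finset.subset_union_left fun t _ _ => hn t _
      _ = H F f := by
          symm
          exact Finset.sum_subset Finset.subset_union_right fun t _ ht => hz t _ (hF t ht)
  have hline : ∀ (F : Finset K) (f : C(K, ℝ)), ConvexOn ℝ univ (fun u : ℝ => H F (u • f)) := by
    intro F f
    have := (hHc F).comp_linearMap (LinearMap.toSpanSingleton ℝ C(K, ℝ) f)
    simpa [Function.comp_def] using this
  have hgauge : ∀ (F : Finset K) (f : C(K, ℝ)) (u : ℝ), 0 < u → H F (u • f) = 1 →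
      (∀ t ∉ F, W t * |(u • f) t| ≤ 1) → gauge B f = u⁻¹ := by
    intro F f u hu h hF
    have hle := hgle f u hu (hsub F _ hF h.le)
    apply le_antisymm
    · rw [← one_div, le_div_iff₀ hu]; linarith
    · by_contra! hlt
      have : u * gauge B f < 1 := by
        rw [← one_div, lt_div_iff₀ hu] at hlt; linarith
      have hev : ∀ᶠ v in 𝓝 u, v * gauge B f < 1 := by
        have : ContinuousAt (fun v : ℝ => v * gauge B f) u := by fun_prop
        exact this.eventually_lt_const (by assumption)
      obtain ⟨v, hv, huv⟩ := ((hev.filter_mono nhdsWithin_le_nhds).and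
        (self_mem_nhdsWithin : ∀ᶠ v in 𝓝[>] u, v ∈ Ioi u)).exists
      have huv : u < v := huv
      have hvB := hmem f v (hu.trans huv) hv F
      have hcv := (hline F f).2 (mem_univ 0) (mem_univ v)
        (show 0 ≤ 1 - u / v by rw [sub_nonneg, div_le_one (hu.trans huv)]; exact huv.le)
        (show 0 ≤ u / v by have := hu.trans huv; positivity) (by ring)
      have hv0 : v ≠ 0 := (hu.trans huv).ne'
      simp only [smul_eq_mul, mul_zero, zero_add, div_mul_cancel₀ _ hv0, h, zero_smul, hH0] at hcv
      have : u / v < 1 := by rw [div_lt_one (hu.trans huv)]; exact huv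
      have : 0 < u / v := div_pos hu (hu.trans huv)
      nlinarith
  have hpos : ∀ f : C(K, ℝ), f ≠ 0 → 0 < gauge B f := fun f hf =>
    lt_of_lt_of_le (norm_pos_iff.2 hf) (hlow f)
  -- local finiteness
  have hfin : ∀ f : C(K, ℝ), f ≠ 0 → ∃ F : Finset K, ∃ η > 0, ∀ t ∉ F,
      W t * |f t| ≤ gauge B f - η := by
    intro f hf
    have hp := hpos f hf
    have : ∃ F : Finset K, ∃ η > 0, ∀ t ∈ (univ : Set K), t ∉ F →
        W t * |f t| ≤ gauge B f - η := by
      refine isCompact_univ.induction_on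
        (p := fun S => ∃ F : Finset K, ∃ η > 0, ∀ t ∈ S, t ∉ F → W t * |f t| ≤ gauge B f - η)
        ⟨∅, 1, one_pos, by simp⟩ ?_ ?_ ?_
      · rintro S T hST ⟨F, η, hη, h⟩
        exact ⟨F, η, hη, fun t ht => h t (hST ht)⟩
      · rintro S T ⟨F, η, hη, h⟩ ⟨F', η', hη', h'⟩
        refine ⟨F ∪ F', min η η', lt_min hη hη', ?_⟩
        rintro t (ht | ht) htF
        · have := h t ht (fun h => htF (Finset.mem_union_left _ h))
          linarith [min_le_left η η']
        · have := h' t ht (fun h => htF (Finset.mem_union_right _ h))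
          linarith [min_le_right η η']
      · intro t _
        obtain ⟨m, hm, hev⟩ := hWV t
        have hlt : m * |f t| < gauge B f := by
          by_cases h0 : f t = 0
          · simpa [h0] using hp
          · have : 0 < |f t| := abs_pos.2 h0
            have := hVle f t
            nlinarith
        obtain ⟨r, hr1, hr2⟩ := exists_between hlt
        have hev2 : ∀ᶠ s in 𝓝 t, m * |f s| < r := by
          have : ContinuousAt (fun s => m * |f s|) t := by fun_prop
          exact this.eventually_lt_const hr1
        rw [eventually_nhdsWithin_iff] at hev
        refine ⟨{s | (s ∈ ({t}ᶜ : Set K) → W s ≤ m) ∧ m * |f s| < r}, ?_, {t},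
          gauge B f - r, by linarith, ?_⟩
        · exact nhdsWithin_le_nhds (hev.and hev2)
        · rintro s ⟨hs1, hs2⟩ hst
          have := hs1 (by simpa using hst)
          have := mul_le_mul_of_nonneg_right this (abs_nonneg (f s))
          linarith
    obtain ⟨F, η, hη, h⟩ := this
    exact ⟨F, η, hη, fun t ht => h t (mem_univ t) ht⟩
  refine ⟨gauge B, fun f g => gauge_add_le hBc habs f g, ?_, ?_, ⟨1, 2, one_pos, two_pos, fun f =>
    ⟨by simpa using hlow f, hup f⟩⟩, ?_⟩
  · intro a f
    rcases le_total 0 a with ha | ha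
    · rw [gauge_smul_of_nonneg ha, abs_of_nonneg ha]; rfl
    · have : a • f = -((-a) • f) := by simp
      rw [this, gauge_neg hBsymm, gauge_smul_of_nonneg (neg_nonneg.2 ha), abs_of_nonpos ha]; rfl
  · intro f
    constructor
    · intro h
      have := hlow f
      rw [h] at this
      exact norm_le_zero_iff.1 this
    · rintro rfl
      exact gauge_zero
  · intro f hf
    have hf : f ≠ 0 := hf
    apply ContDiffAt.contDiffWithinAt
    obtain ⟨F, η, hη, hF⟩ := hfin f hf
    have hp := hpos f hf
    set p := gauge B f with hpdef
    let G : C(K, ℝ) × ℝ → ℝ := fun z => H F (z.2 • z.1)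
    have hG : ContDiff ℝ ((⊤ : ℕ∞) : WithTop ℕ∞) G := by
      refine ContDiff.sum fun t _ => (hd t).comp ?_
      have h1 : ContDiff ℝ ((⊤ : ℕ∞) : WithTop ℕ∞) (fun z : C(K, ℝ) × ℝ => z.2 * z.1 t) :=
        contDiff_snd.mul (ContDiff.comp (g := fun h : C(K, ℝ) => h t)
          (ContinuousMap.evalCLM ℝ t : C(K, ℝ) →L[ℝ] ℝ).contDiff contDiff_fst)
      exact h1
    -- near `(f, 1/p)` the coordinates outside `F` vanish
    have hnear : ∀ᶠ z : C(K, ℝ) × ℝ in 𝓝 (f, p⁻¹), 0 < z.2 ∧ ∀ t ∉ F, W t * |(z.2 • z.1) t| ≤ 1 := by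
      have hev : ∀ᶠ z : C(K, ℝ) × ℝ in 𝓝 (f, p⁻¹), z.2 * (p - η + 2 * ‖z.1 - f‖) < 1 := by
        have hcont : ContinuousAt (fun z : C(K, ℝ) × ℝ => z.2 * (p - η + 2 * ‖z.1 - f‖)) (f, p⁻¹) := by
          fun_prop
        refine hcont.eventually_lt_const ?_
        simp only [sub_self, norm_zero, mul_zero, add_zero]
        rw [inv_mul_lt_iff₀ hp]; linarith
      have hev2 : ∀ᶠ z : C(K, ℝ) × ℝ in 𝓝 (f, p⁻¹), 0 < z.2 := by
        have hcont : ContinuousAt (fun z : C(K, ℝ) × ℝ => z.2) (f, p⁻¹) := by fun_prop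
        exact hcont.eventually_const_lt (inv_pos.2 hp)
      filter_upwards [hev, hev2] with z hz1 hz2
      refine ⟨hz2, fun t ht => ?_⟩
      have a1 := hF t ht
      have a2 : |z.1 t| ≤ |f t| + ‖z.1 - f‖ := by
        have b1 := (z.1 - f).norm_coe_le_norm t
        rw [Real.norm_eq_abs, ContinuousMap.sub_apply] at b1
        have b2 := abs_sub_abs_le_abs_sub (z.1 t) (f t)
        linarith
      have a3 : W t * |z.1 t| ≤ p - η + 2 * ‖z.1 - f‖ := by
        have c1 := mul_le_mul_of_nonneg_left a2 (hW0 t)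
        have c2 := mul_le_mul_of_nonneg_right (hW t) (norm_nonneg (z.1 - f))
        linarith
      rw [ContinuousMap.smul_apply, smul_eq_mul, abs_mul, abs_of_pos hz2, mul_left_comm]
      have := mul_le_mul_of_nonneg_left a3 hz2.le
      linarith
    have hcurve : Continuous (fun u : ℝ => ((f, u) : C(K, ℝ) × ℝ)) := by fun_prop
    have hnear1 : ∀ᶠ u : ℝ in 𝓝 p⁻¹, 0 < u ∧ ∀ t ∉ F, W t * |(u • f) t| ≤ 1 :=
      hcurve.continuousAt.eventually hnear
    have hGc : Continuous (fun u : ℝ => H F (u • f)) := hG.continuous.comp hcurve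
    have hG1 : G (f, p⁻¹) = 1 := by
      show H F (p⁻¹ • f) = 1
      apply le_antisymm
      · refine le_of_tendsto (f := fun u : ℝ => H F (u • f)) (x := 𝓝[<] p⁻¹)
          (hGc.continuousAt.mono_left nhdsWithin_le_nhds) ?_
        filter_upwards [self_mem_nhdsWithin, nhdsWithin_le_nhds hnear1] with u hu hu2
        refine hmem f u hu2.1 ?_ F
        have hu : u < p⁻¹ := hu
        rw [← one_div, lt_div_iff₀ hp] at hu
        exact hu
      · by_contra! hlt
        have hev : ∀ᶠ u in 𝓝 p⁻¹, H F (u • f) < 1 := hGc.continuousAt.eventually_lt_const hlt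
        obtain ⟨u, ⟨hu1, hu2⟩, hu3⟩ :=
          (((hev.and hnear1).filter_mono nhdsWithin_le_nhds).and
          (self_mem_nhdsWithin : ∀ᶠ v in 𝓝[>] p⁻¹, v ∈ Ioi p⁻¹)).exists
        have hu3 : p⁻¹ < u := hu3
        have := hgle f u hu2.1 (hsub F _ hu2.2 hu1.le)
        rw [← one_div, div_lt_iff₀ hp] at hu3
        linarith
    have hGat : ContDiffAt ℝ ((⊤ : ℕ∞) : WithTop ℕ∞) G (f, p⁻¹) := hG.contDiffAt
    have hne : ((⊤ : ℕ∞) : WithTop ℕ∞) ≠ 0 := by simp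
    have hder : HasDerivAt (fun u : ℝ => H F (u • f)) (fderiv ℝ G (f, p⁻¹) (0, 1)) p⁻¹ := by
      have d1 := (hGat.differentiableAt hne).hasFDerivAt
      have d2 : HasDerivAt (fun u : ℝ => ((f, u) : C(K, ℝ) × ℝ)) (0, 1) p⁻¹ :=
        (hasDerivAt_const _ _).prodMk (hasDerivAt_id _)
      exact d1.comp_hasDerivAt p⁻¹ d2
    have hdpos : 0 < fderiv ℝ G (f, p⁻¹) (0, 1) := by
      have := (hline F f).slope_le_of_hasDerivAt (mem_univ 0) (mem_univ p⁻¹) (inv_pos.2 hp) hder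
      have hG1' : H F (p⁻¹ • f) = 1 := hG1
      rw [slope_def_field] at this
      simp only [hG1', zero_smul, hH0, sub_zero, one_div, inv_inv] at this
      linarith
    have hinv : (fderiv ℝ G (f, p⁻¹) ∘L .inr ℝ C(K, ℝ) ℝ).IsInvertible := by
      refine ⟨ContinuousLinearEquiv.unitsEquivAut ℝ (Units.mk0 _ hdpos.ne'), ?_⟩
      ext
      simp
    let ψ := hGat.implicitFunction hne hinv
    have hψd : ContDiffAt ℝ ((⊤ : ℕ∞) : WithTop ℕ∞) ψ f :=
      hGat.contDiffAt_implicitFunction hne hinv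
    have hψ0 : ψ f = p⁻¹ := hGat.implicitFunction_apply_self hne hinv
    have hψe : ∀ᶠ g in 𝓝 f, G (g, ψ g) = G (f, p⁻¹) :=
      hGat.eventually_apply_implicitFunction hne hinv
    have hψn : ∀ᶠ g in 𝓝 f, 0 < ψ g ∧ ∀ t ∉ F, W t * |(ψ g • g) t| ≤ 1 := by
      have : Tendsto (fun g => (g, ψ g)) (𝓝 f) (𝓝 (f, p⁻¹)) := by
        have h2 := hψd.continuousAt
        rw [ContinuousAt, hψ0] at h2
        exact tendsto_id.prodMk_nhds h2
      exact this.eventually hnear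
    have hfinal : ContDiffAt ℝ ((⊤ : ℕ∞) : WithTop ℕ∞) (fun g => (ψ g)⁻¹) f :=
      hψd.inv (by rw [hψ0]; positivity)
    refine hfinal.congr_of_eventuallyEq ?_
    filter_upwards [hψe, hψn] with g hg1 hg2
    rw [hG1] at hg1
    exact hgauge F g (ψ g) hg2.1 hg1 hg2.2

theorem stmt_10 (K : Type*) [TopologicalSpace K] [CompactSpace K] [T2Space K]
    (D : ℕ → Set K)
    (hdisj : Pairwise (Function.onFun Disjoint D))
    (hcover : ⋃ i, D i = Set.univ)
    (hdiscr : ∀ i, D i ∩ derivedSet (D i) = ∅) :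
    ∃ N : C(K, ℝ) → ℝ,
      (∀ f g : C(K, ℝ), N (f + g) ≤ N f + N g) ∧
      (∀ (a : ℝ) (f : C(K, ℝ)), N (a • f) = |a| * N f) ∧
      (∀ f : C(K, ℝ), N f = 0 ↔ f = 0) ∧
      (∃ c C : ℝ, 0 < c ∧ 0 < C ∧ ∀ f : C(K, ℝ), c * ‖f‖ ≤ N f ∧ N f ≤ C * ‖f‖) ∧
      ContDiffOn ℝ ((⊤ : ℕ∞) : WithTop ℕ∞) N {f : C(K, ℝ) | f ≠ 0} := by
  obtain ⟨W, V, hWV⟩ := aux_weights D hcover hdiscr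
  obtain ⟨Φ, hd, hc, he, hn, hz, hm⟩ := aux_phi
  have hV : ∀ t, 0 < V t := fun t => by linarith [(hWV t).1]
  have hW : ∀ t, 0 < W t := fun t => (hV t).trans (hWV t).2.1
  have hq : ∀ t, 1 < W t / V t := fun t => (one_lt_div (hV t)).2 (hWV t).2.1
  have hΦ : ∀ t, 0 < Φ (W t / V t) := fun t => (hm _ _ (hq t) (le_abs_self _)).1
  refine aux_main K (fun t x => 2 / Φ (W t / V t) * Φ (W t * x)) W V ?_ ?_ ?_ ?_ ?_ ?_
    (fun t => (hWV t).1) (fun t => (hW t).le) (fun t => (hWV t).2.2.1) (fun t => (hWV t).2.2.2)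
  · intro t
    exact contDiff_const.mul (hd.comp (contDiff_const.mul contDiff_id))
  · intro t
    have h1 := hc.comp_linearMap (LinearMap.mulLeft ℝ (W t))
    have h2 := h1.smul (show 0 ≤ 2 / Φ (W t / V t) by have := hΦ t; positivity)
    simpa [Function.comp_def] using h2
  · intro t x
    simp only [mul_neg, he]
  · intro t x
    have := hΦ t
    have := hn (W t * x)
    positivity
  · intro t x hx
    have : Φ (W t * x) = 0 := hz _ (by rwa [abs_mul, abs_of_pos (hW t)])
    simp only [this, mul_zero]
  · intro t x hx
    by_contra! h
    have h2 : W t / V t ≤ |W t * x| := by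
      rw [abs_mul, abs_of_pos (hW t), div_le_iff₀ (hV t)]
      nlinarith [hW t]
    have h3 := (hm _ _ (hq t) h2).2
    have h4 := hΦ t
    have h5 : 2 / Φ (W t / V t) * Φ (W t / V t) = 2 := by field_simp
    have h6 : 2 / Φ (W t / V t) * Φ (W t / V t) ≤ 2 / Φ (W t / V t) * Φ (W t * x) := by gcongr
    linarith
end

section
/- Let K be a compact Hausdorff space and let m be a natural number or ∞. If C(K) admits a bump function of class C^m, then every continuous function Φ : C(K) → ℝ can be uniformly approximated by functions of class C^m: for every ε > 0 there exists Ψ : C(K) → ℝ of class C^m such that |Φ(f) − Ψ(f)| ≤ ε for all f ∈ C(K). -/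
open Filter Topology

/-- Gluing countably many local approximations. -/
theorem aux_glue {E : Type*} [NormedAddCommGroup E] [NormedSpace ℝ E] (m : WithTop ℕ∞)
    (Φ : E → ℝ) (ε : ℝ) (u w : ℕ → E → ℝ)
    (hu : ∀ n, ContDiff ℝ m (u n)) (hw : ∀ n, ContDiff ℝ m (w n))
    (h0 : ∀ n x, 0 ≤ u n x) (h1 : ∀ n x, u n x ≤ 1)
    (hap : ∀ n x, |u n x * Φ x - w n x| ≤ ε * u n x)
    (hcov : ∀ x, ∃ n, ∀ᶠ y in 𝓝 x, u n y = 1) :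
    ∃ Ψ : E → ℝ, ContDiff ℝ m Ψ ∧ ∀ x, |Φ x - Ψ x| ≤ ε := by
  have key : ∀ N x, u N x = 1 →
      (∑' n, w n x * ∏ k ∈ Finset.range n, (1 - u k x)) =
        ∑ n ∈ Finset.range (N + 1), w n x * ∏ k ∈ Finset.range n, (1 - u k x) := by
    intro N x hN
    apply tsum_eq_sum
    intro n hn
    have : N ∈ Finset.range n := by
      simp only [Finset.mem_range, not_lt] at hn ⊢
      omega
    rw [Finset.prod_eq_zero this (by rw [hN]; ring), mul_zero]
  refine ⟨fun x => ∑' n, w n x * ∏ k ∈ Finset.range n, (1 - u k x), ?_, ?_⟩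
  · rw [contDiff_iff_contDiffAt]
    intro x
    obtain ⟨N, hN⟩ := hcov x
    have hs : ContDiff ℝ m (fun x => ∑ n ∈ Finset.range (N + 1),
        w n x * ∏ k ∈ Finset.range n, (1 - u k x)) := by
      apply ContDiff.sum
      intro n _
      apply (hw n).mul
      apply contDiff_prod
      intro k _
      exact contDiff_const.sub (hu k)
    refine hs.contDiffAt.congr_of_eventuallyEq ?_
    filter_upwards [hN] with y hy using key N y hy
  · intro x
    obtain ⟨N, hN⟩ := hcov x
    have hN := hN.self_of_nhds
    simp only []
    rw [key N x hN]
    have htel : ∀ M, ∑ n ∈ Finset.range M, u n x * ∏ k ∈ Finset.range n, (1 - u k x)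
        = 1 - ∏ k ∈ Finset.range M, (1 - u k x) := by
      intro M
      induction M with
      | zero => simp
      | succ M ih => rw [Finset.sum_range_succ, ih, Finset.prod_range_succ]; ring
    have h2 : ∑ n ∈ Finset.range (N+1), u n x * ∏ k ∈ Finset.range n, (1 - u k x) = 1 := by
      rw [htel, Finset.prod_eq_zero (Finset.self_mem_range_succ N) (by rw [hN]; ring)]
      ring
    have h3 : Φ x - ∑ n ∈ Finset.range (N + 1), w n x * ∏ k ∈ Finset.range n, (1 - u k x)
        = ∑ n ∈ Finset.range (N + 1),
          (u n x * Φ x - w n x) * ∏ k ∈ Finset.range n, (1 - u k x) := by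
      have : Φ x = ∑ n ∈ Finset.range (N+1),
          (u n x * ∏ k ∈ Finset.range n, (1 - u k x)) * Φ x := by
        rw [← Finset.sum_mul, h2, one_mul]
      conv_lhs => rw [this]
      rw [← Finset.sum_sub_distrib]
      refine Finset.sum_congr rfl fun n _ => ?_
      ring
    rw [h3]
    calc _ ≤ ∑ n ∈ Finset.range (N + 1),
          |(u n x * Φ x - w n x) * ∏ k ∈ Finset.range n, (1 - u k x)| :=
            Finset.abs_sum_le_sum_abs _ _
      _ ≤ ∑ n ∈ Finset.range (N + 1),
          ε * (u n x * ∏ k ∈ Finset.range n, (1 - u k x)) := by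
            refine Finset.sum_le_sum fun n _ => ?_
            have hp : 0 ≤ ∏ k ∈ Finset.range n, (1 - u k x) :=
              Finset.prod_nonneg fun k _ => by linarith [h1 k x]
            rw [abs_mul, abs_of_nonneg hp, ← mul_assoc]
            exact mul_le_mul_of_nonneg_right (hap n x) hp
      _ = ε := by rw [← Finset.mul_sum, h2, mul_one]

/-- A rough Banach space has no differentiable bump (Leach–Whitfield). -/
theorem aux_rough {E : Type*} [NormedAddCommGroup E] [NormedSpace ℝ E] [CompleteSpace E]
    (hr : ∀ (x : E) (δ : ℝ), 0 < δ → ∃ h : E, 0 < ‖h‖ ∧ ‖h‖ ≤ δ ∧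
      ‖x‖ + ‖h‖ / 2 ≤ ‖x + h‖ ∧ ‖x‖ + ‖h‖ / 2 ≤ ‖x - h‖)
    (φ : E → ℝ) (hφ : Differentiable ℝ φ) (h0 : φ 0 = 1) (R : ℝ) (hR : 0 < R)
    (hs : ∀ x, R ≤ ‖x‖ → φ x = 0) : False := by
  set η : ℝ := 1 / (2 * R) with hη
  have hηp : 0 < η := by positivity
  have hηR : η * R = 1 / 2 := by rw [hη]; field_simp
  let r : E → E → Prop := fun x y => φ x - η * (‖y‖ - ‖x‖) ≤ φ y ∧ ‖y - x‖ / 2 ≤ ‖y‖ - ‖x‖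
  have rrefl : ∀ x, r x x := fun x => by simp [r]
  have rtrans : ∀ x y z, r x y → r y z → r x z := by
    rintro x y z ⟨a, b⟩ ⟨c, d⟩
    refine ⟨by nlinarith, ?_⟩
    have : ‖z - x‖ ≤ ‖z - y‖ + ‖y - x‖ := norm_sub_le_norm_sub_add_norm_sub _ _ _
    linarith
  -- the near-optimal successor
  have hsucc : ∀ x, ‖x‖ ≤ R → ∃ y, ‖y‖ ≤ R ∧ r x y ∧
      ∀ z, ‖z‖ ≤ R → r x z → ‖z‖ ≤ 2 * ‖y‖ - ‖x‖ := by
    intro x hx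
    let T : Set ℝ := {t | ∃ z, ‖z‖ ≤ R ∧ r x z ∧ ‖z‖ = t}
    have hTb : BddAbove T := ⟨R, by rintro t ⟨z, hz, _, rfl⟩; exact hz⟩
    have hTx : ‖x‖ ∈ T := ⟨x, hx, rrefl x, rfl⟩
    have hle : ‖x‖ ≤ sSup T := le_csSup hTb hTx
    rcases hle.eq_or_lt with he | hl
    · refine ⟨x, hx, rrefl x, fun z hz hxz => ?_⟩
      have : ‖z‖ ≤ sSup T := le_csSup hTb ⟨z, hz, hxz, rfl⟩
      linarith
    · obtain ⟨t, ⟨y, hy, hxy, rfl⟩, hty⟩ :=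
        exists_lt_of_lt_csSup ⟨_, hTx⟩ (show (‖x‖ + sSup T) / 2 < sSup T by linarith)
      refine ⟨y, hy, hxy, fun z hz hxz => ?_⟩
      have : ‖z‖ ≤ sSup T := le_csSup hTb ⟨z, hz, hxz, rfl⟩
      linarith
  choose! f hf1 hf2 hf3 using hsucc
  let x : ℕ → E := fun n => f^[n] 0
  have hxs : ∀ n, x (n + 1) = f (x n) := fun n => Function.iterate_succ_apply' f n 0
  have hx0 : x 0 = 0 := rfl
  have hxR : ∀ n, ‖x n‖ ≤ R := by
    intro n
    induction n with
    | zero => rw [hx0, norm_zero]; exact hR.le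
    | succ n ih => rw [hxs]; exact hf1 _ ih
  have hxr1 : ∀ n, r (x n) (x (n + 1)) := fun n => by rw [hxs]; exact hf2 _ (hxR n)
  have hxr : ∀ n k, r (x n) (x (n + k)) := by
    intro n k
    induction k with
    | zero => exact rrefl _
    | succ k ih => exact rtrans _ _ _ ih (hxr1 _)
  have hmono : Monotone fun n => ‖x n‖ := by
    apply monotone_nat_of_le_succ
    intro n
    have := (hxr1 n).2
    have h2 := norm_nonneg (x (n+1) - x n)
    linarith
  have hbdd : BddAbove (Set.range fun n => ‖x n‖) := ⟨R, by rintro _ ⟨n, rfl⟩; exact hxR n⟩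
  have hlim := tendsto_atTop_ciSup hmono hbdd
  have hcN : CauchySeq fun n => ‖x n‖ := hlim.cauchySeq
  have hc : CauchySeq x := by
    rw [Metric.cauchySeq_iff'] at hcN ⊢
    intro e he
    obtain ⟨N, hN⟩ := hcN (e / 2) (by linarith)
    refine ⟨N, fun n hn => ?_⟩
    have h1 := hN n hn
    obtain ⟨k, rfl⟩ := Nat.exists_eq_add_of_le hn
    have h2 := (hxr N k).2
    rw [Real.dist_eq] at h1
    rw [dist_eq_norm]
    have := le_abs_self (‖x (N + k)‖ - ‖x N‖)
    linarith
  obtain ⟨a, ha⟩ := cauchySeq_tendsto_of_complete hc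
  have hna : Tendsto (fun n => ‖x n‖) atTop (𝓝 ‖a‖) := ha.norm
  have haR : ‖a‖ ≤ R := le_of_tendsto' hna hxR
  have hra : ∀ n, r (x n) a := by
    intro n
    have ha' : Tendsto (fun k => x (n + k)) atTop (𝓝 a) := by
      simpa [add_comm] using (tendsto_add_atTop_iff_nat n).2 ha
    constructor
    · exact le_of_tendsto_of_tendsto'
        (tendsto_const_nhds.sub ((ha'.norm.sub tendsto_const_nhds).const_mul η))
        ((hφ.continuous.tendsto a).comp ha') fun k => (hxr n k).1
    · exact le_of_tendsto_of_tendsto'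
        ((ha'.sub tendsto_const_nhds).norm.div_const 2)
        (ha'.norm.sub tendsto_const_nhds) fun k => (hxr n k).2
  have haφ : 1 / 2 ≤ φ a := by
    have := (hra 0).1
    rw [hx0, h0, norm_zero, sub_zero] at this
    nlinarith
  have haR' : ‖a‖ < R := by
    by_contra hcon
    have := hs a (not_lt.1 hcon)
    linarith
  -- a strict successor of the limit
  obtain ⟨y, hyR, hay, hylt⟩ : ∃ y, ‖y‖ ≤ R ∧ r a y ∧ ‖a‖ < ‖y‖ := by
    have hd := (hφ a).hasFDerivAt
    rw [hasFDerivAt_iff_isLittleO_nhds_zero] at hd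
    have hd2 := hd.def (show 0 < η / 2 by positivity)
    obtain ⟨δ, hδ, hball⟩ := Metric.eventually_nhds_iff.1 hd2
    obtain ⟨h, hh0, hhδ, hp, hm⟩ := hr a (min (δ / 2) (R - ‖a‖))
      (lt_min (by linarith) (by linarith))
    have hhδ1 : ‖h‖ < δ := by linarith [min_le_left (δ / 2) (R - ‖a‖)]
    have hhδ2 : ‖h‖ ≤ R - ‖a‖ := hhδ.trans (min_le_right _ _)
    have main : ∀ g : E, ‖g‖ = ‖h‖ → ‖a‖ + ‖h‖ / 2 ≤ ‖a + g‖ → 0 ≤ fderiv ℝ φ a g →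
        ∃ y, ‖y‖ ≤ R ∧ r a y ∧ ‖a‖ < ‖y‖ := by
      intro g hg hge hpos
      have h1 := hball (y := g) (by rw [dist_zero_right, hg]; exact hhδ1)
      rw [Real.norm_eq_abs, hg] at h1
      have h2 := (abs_le.1 h1).1
      refine ⟨a + g, ?_, ⟨?_, ?_⟩, ?_⟩
      · have := norm_add_le a g
        linarith
      · nlinarith
      · rw [add_sub_cancel_left, hg]; linarith
      · linarith
    rcases le_total 0 (fderiv ℝ φ a h) with hsg | hsg
    · exact main h rfl hp hsg
    · exact main (-h) (norm_neg h) (by rw [← sub_eq_add_neg]; exact hm)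
        (by rw [map_neg]; linarith)
  have hfin : ∀ n, ‖y‖ ≤ 2 * ‖x (n + 1)‖ - ‖x n‖ := by
    intro n
    rw [hxs]
    exact hf3 _ (hxR n) y hyR (rtrans _ _ _ (hra n) hay)
  have h1 : Tendsto (fun n => 2 * ‖x (n + 1)‖ - ‖x n‖) atTop (𝓝 (2 * ‖a‖ - ‖a‖)) :=
    (((tendsto_add_atTop_iff_nat 1).2 hna).const_mul 2).sub hna
  have := ge_of_tendsto' h1 hfin
  linarith

/-- `C[a,b]` is rough. -/
theorem aux_rough_interval (a b : ℝ) (hab : a < b) (x : C(Set.Icc a b, ℝ)) (δ : ℝ) (hδ : 0 < δ) :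
    ∃ h : C(Set.Icc a b, ℝ), 0 < ‖h‖ ∧ ‖h‖ ≤ δ ∧
      ‖x‖ + ‖h‖ / 2 ≤ ‖x + h‖ ∧ ‖x‖ + ‖h‖ / 2 ≤ ‖x - h‖ := by
  have : Nonempty (Set.Icc a b) := ⟨⟨a, le_refl a, hab.le⟩⟩
  obtain ⟨t, -, ht⟩ := isCompact_univ.exists_isMaxOn (Set.univ_nonempty (α := Set.Icc a b))
    (continuous_norm.comp x.continuous).continuousOn
  have hxt : ‖x‖ = |x t| := by
    apply le_antisymm
    · rw [ContinuousMap.norm_le _ (abs_nonneg _)]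
      intro s
      exact ht (Set.mem_univ s)
    · exact x.norm_coe_le_norm t
  -- a second point close to t
  have hcont : ∀ᶠ s in 𝓝 t, |x s - x t| < δ / 2 := by
    have := x.continuous.continuousAt (x := t)
    exact (Metric.tendsto_nhds.1 this) (δ / 2) (by linarith)
  obtain ⟨r, hr, hball⟩ := Metric.eventually_nhds_iff.1 hcont
  obtain ⟨s, hst, hs⟩ : ∃ s : Set.Icc a b, s ≠ t ∧ dist s t < r := by
    obtain ⟨t, ht1, ht2⟩ := t
    rcases lt_or_ge t b with h | h
    · refine ⟨⟨t + min (r / 2) (b - t), ?_, ?_⟩, ?_, ?_⟩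
      · have : 0 < min (r / 2) (b - t) := lt_min (by linarith) (by linarith)
        linarith
      · linarith [min_le_right (r / 2) (b - t)]
      · intro hh
        have : 0 < min (r / 2) (b - t) := lt_min (by linarith) (by linarith)
        have := congrArg Subtype.val hh
        simp only at this
        linarith
      · have : 0 < min (r / 2) (b - t) := lt_min (by linarith) (by linarith)
        rw [Subtype.dist_eq, Real.dist_eq]
        simp only [add_sub_cancel_left]
        rw [abs_of_pos this]
        linarith [min_le_left (r / 2) (b - t)]
    · refine ⟨⟨t - min (r / 2) (b - a), ?_, ?_⟩, ?_, ?_⟩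
      · linarith [min_le_right (r / 2) (b - a)]
      · have : 0 < min (r / 2) (b - a) := lt_min (by linarith) (by linarith)
        linarith
      · intro hh
        have : 0 < min (r / 2) (b - a) := lt_min (by linarith) (by linarith)
        have := congrArg Subtype.val hh
        simp only at this
        linarith
      · have : 0 < min (r / 2) (b - a) := lt_min (by linarith) (by linarith)
        rw [Subtype.dist_eq, Real.dist_eq, abs_sub_comm]
        simp only [sub_sub_cancel]
        rw [abs_of_pos this]
        linarith [min_le_left (r / 2) (b - a)]
  have hxs := hball hs
  obtain ⟨g, hg0, hg1, hg01⟩ := exists_continuous_zero_one_of_isClosed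
    (isClosed_singleton (x := s)) (isClosed_singleton (x := t))
    (Set.disjoint_singleton.2 hst)
  have hgs : g s = 0 := hg0 rfl
  have hgt : g t = 1 := hg1 rfl
  let h : C(Set.Icc a b, ℝ) := δ • ((2:ℝ) • g - 1)
  have hh : ∀ u, h u = δ * (2 * g u - 1) := fun u => by simp [h]
  have hhs : h s = -δ := by rw [hh, hgs]; ring
  have hht : h t = δ := by rw [hh, hgt]; ring
  have hn : ‖h‖ = δ := by
    apply le_antisymm
    · rw [ContinuousMap.norm_le _ hδ.le]
      intro u
      have := hg01 u
      rw [hh, Real.norm_eq_abs, abs_le]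
      constructor <;> nlinarith [this.1, this.2]
    · have := h.norm_coe_le_norm t
      rw [hht, Real.norm_eq_abs, abs_of_pos hδ] at this
      exact this
  have ev : ∀ (f : C(Set.Icc a b, ℝ)) u, |f u| ≤ ‖f‖ := fun f u => f.norm_coe_le_norm u
  refine ⟨h, by rw [hn]; exact hδ, hn.le, ?_, ?_⟩
  · rw [hn, hxt]
    have e1 := ev (x + h) t
    have e2 := ev (x + h) s
    rw [ContinuousMap.add_apply, hht] at e1
    rw [ContinuousMap.add_apply, hhs] at e2
    have := abs_lt.1 hxs
    have := abs_le.1 e1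
    have := abs_le.1 e2
    rcases abs_cases (x t) with ⟨h1, _⟩ | ⟨h1, _⟩ <;> rw [h1] <;> linarith
  · rw [hn, hxt]
    have e1 := ev (x - h) t
    have e2 := ev (x - h) s
    rw [ContinuousMap.sub_apply, hht] at e1
    rw [ContinuousMap.sub_apply, hhs] at e2
    have := abs_lt.1 hxs
    have := abs_le.1 e1
    have := abs_le.1 e2
    rcases abs_cases (x t) with ⟨h1, _⟩ | ⟨h1, _⟩ <;> rw [h1] <;> linarith

/-- If `C(K)` has a differentiable bump, then no continuous function on `K` has an interval in
its range. -/
theorem aux_gap {K : Type*} [TopologicalSpace K] [CompactSpace K]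
    (φ : C(K, ℝ) → ℝ) (hφ : Differentiable ℝ φ) (h0 : φ 0 = 1) (R : ℝ)
    (hR : 0 < R) (hs : ∀ x, R ≤ ‖x‖ → φ x = 0)
    (g : C(K, ℝ)) (a b : ℝ) (hab : a < b) : ∃ t ∈ Set.Icc a b, ∀ k, g k ≠ t := by
  by_contra hcon
  push Not at hcon
  let p : C(K, Set.Icc a b) := ⟨fun k => Set.projIcc a b hab.le (g k),
    continuous_projIcc.comp g.continuous⟩
  have hp : Function.Surjective p := by
    intro t
    obtain ⟨k, hk⟩ := hcon t t.2
    refine ⟨k, ?_⟩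
    change Set.projIcc a b hab.le (g k) = t
    rw [hk, Set.projIcc_val]
  let J : C(Set.Icc a b, ℝ) →ₗ[ℝ] C(K, ℝ) :=
    { toFun := fun f => f.comp p
      map_add' := fun f f' => rfl
      map_smul' := fun c f => rfl }
  have hJle : ∀ f, ‖J f‖ ≤ ‖f‖ := by
    intro f
    rw [ContinuousMap.norm_le _ (norm_nonneg f)]
    intro k
    exact f.norm_coe_le_norm (p k)
  have hJge : ∀ f, ‖f‖ ≤ ‖J f‖ := by
    intro f
    rw [ContinuousMap.norm_le _ (norm_nonneg _)]
    intro t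
    obtain ⟨k, rfl⟩ := hp t
    exact (J f).norm_coe_le_norm k
  let J' : C(Set.Icc a b, ℝ) →L[ℝ] C(K, ℝ) := J.mkContinuous 1 (by simpa using hJle)
  refine aux_rough (aux_rough_interval a b hab) (fun f => φ (J' f))
    (hφ.comp J'.differentiable) (by simp [h0]) R hR ?_
  intro f hf
  exact hs _ (hf.trans (hJge f))

theorem aux_exp {K : Type*} [TopologicalSpace K] [CompactSpace K] (f : C(K, ℝ)) (k : K) :
    (NormedSpace.exp f) k = Real.exp (f k) := by
  rw [Real.exp_eq_exp_ℝ]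
  exact NormedSpace.map_exp (ContinuousMap.evalAlgHom ℝ ℝ k)
    (continuous_eval_const k) f

/-- Smooth test for avoiding a neighbourhood of the value `c`. -/
theorem aux_test {K : Type*} [TopologicalSpace K] [CompactSpace K] (m : ℕ∞)
    (φ : C(K, ℝ) → ℝ) (hφ : ContDiff ℝ m φ) (h0 : φ 0 = 1) (R : ℝ)
    (hR : 0 < R) (hs : ∀ x, R ≤ ‖x‖ → φ x = 0) (c ρ : ℝ) (hρ : 0 < ρ) :
    ∃ Θ : C(K, ℝ) → ℝ, ContDiff ℝ m Θ ∧ (∀ h, 0 ≤ Θ h) ∧ (∀ h, Θ h ≤ 1) ∧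
      (∀ h k, |h k - c| < ρ → Θ h = 0) ∧ (∀ h, (∀ k, 2 * ρ ≤ |h k - c|) → Θ h = 1) := by
  obtain ⟨r, hr, hball⟩ : ∃ r > 0, ∀ x, ‖x‖ ≤ r → 1 / 2 ≤ φ x := by
    have : ∀ᶠ x in 𝓝 (0 : C(K, ℝ)), 1 / 2 < φ x := by
      refine (hφ.continuous.tendsto 0).eventually_const_lt ?_
      rw [h0]; norm_num
    obtain ⟨r, hr, h⟩ := Metric.eventually_nhds_iff.1 this
    refine ⟨r / 2, by linarith, fun x hx => (h ?_).le⟩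
    rw [dist_zero_right]; linarith
  obtain ⟨A, hA, hA2⟩ : ∃ A : ℝ, 0 < A ∧ R * Real.exp (-(3 * ρ ^ 2 * A)) ≤ r := by
    have h1 : Tendsto (fun A : ℝ => R * Real.exp (-(3 * ρ ^ 2 * A))) atTop (𝓝 (R * 0)) := by
      refine Tendsto.const_mul R ?_
      refine Real.tendsto_exp_neg_atTop_nhds_zero.comp ?_
      exact tendsto_id.const_mul_atTop (by positivity)
    rw [mul_zero] at h1
    obtain ⟨A, h2, h3⟩ := ((h1.eventually_lt_const hr).and (eventually_gt_atTop 0)).exists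
    exact ⟨A, h3, h2.le⟩
  let B : ℝ := R * Real.exp (A * ρ ^ 2)
  let N : C(K, ℝ) → C(K, ℝ) := fun h =>
    B • NormedSpace.exp ((-A) • ((h - ContinuousMap.const K c) * (h - ContinuousMap.const K c)))
  have hNk : ∀ h k, N h k = R * Real.exp (A * ρ ^ 2 - A * |h k - c| ^ 2) := by
    intro h k
    simp only [N, ContinuousMap.smul_apply, aux_exp, ContinuousMap.mul_apply,
      ContinuousMap.sub_apply, ContinuousMap.const_apply, smul_eq_mul, B, sq_abs]
    rw [mul_assoc, ← Real.exp_add]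
    ring_nf
  have hexp : ContDiff ℝ m (NormedSpace.exp : C(K, ℝ) → C(K, ℝ)) := by
    rw [contDiff_iff_contDiffAt]
    intro x
    exact (NormedSpace.exp_analytic (𝕂 := ℝ) x).contDiffAt
  have hN : ContDiff ℝ m N := by
    have hsub : ContDiff ℝ m (fun h : C(K, ℝ) => h - ContinuousMap.const K c) :=
      contDiff_id.sub contDiff_const
    exact (hexp.comp ((hsub.mul hsub).const_smul (-A))).const_smul B
  refine ⟨fun h => Real.smoothTransition (2 * φ (N h)), ?_, fun _ => Real.smoothTransition.nonneg _,
    fun _ => Real.smoothTransition.le_one _, ?_, ?_⟩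
  · exact Real.smoothTransition.contDiff.comp (contDiff_const.mul (hφ.comp hN))
  · intro h k hk
    have : R ≤ ‖N h‖ := by
      refine le_trans ?_ ((le_abs_self _).trans ((N h).norm_coe_le_norm k))
      rw [hNk]
      have : |h k - c| ^ 2 ≤ ρ ^ 2 := pow_le_pow_left₀ (abs_nonneg _) hk.le 2
      have : 1 ≤ Real.exp (A * ρ ^ 2 - A * |h k - c| ^ 2) := by
        apply Real.one_le_exp
        nlinarith
      nlinarith
    apply Real.smoothTransition.zero_of_nonpos
    rw [hs _ this, mul_zero]
  · intro h hk
    have : ‖N h‖ ≤ r := by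
      rw [ContinuousMap.norm_le _ hr.le]
      intro k
      rw [hNk, Real.norm_eq_abs, abs_of_pos (by positivity)]
      refine le_trans ?_ hA2
      have h1 : (2 * ρ) ^ 2 ≤ |h k - c| ^ 2 := pow_le_pow_left₀ (by positivity) (hk k) 2
      gcongr
      nlinarith
    apply Real.smoothTransition.one_of_one_le
    linarith [hball _ this]

/-- Position of the values of `h` relative to the cut points `S`. -/
def auxSig {K : Type*} [TopologicalSpace K] (S : Finset ℚ) (h : C(K, ℝ)) : K → Set ℚ :=
  fun k => {c | c ∈ S ∧ h k < c}

theorem aux_sig_eq {K : Type*} [TopologicalSpace K] [CompactSpace K] (S : Finset ℚ)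
    (h h' : C(K, ℝ)) (ρ : ℝ) (hh : ∀ c ∈ S, ∀ k, ρ ≤ |h k - (c : ℝ)|) (hd : dist h' h < ρ) :
    auxSig S h' = auxSig S h := by
  funext k
  ext c
  simp only [auxSig, Set.mem_ofPred_eq]
  refine and_congr_right fun hc => ?_
  have h1 := hh c hc k
  have h2 : |h' k - h k| < ρ := lt_of_le_of_lt (ContinuousMap.dist_apply_le_dist (f := h') (g := h) k) hd
  have h3 := abs_lt.1 h2
  rcases le_abs.1 h1 with h4 | h4
  · constructor <;> intro h5 <;> linarith
  · constructor <;> intro h5 <;> linarith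

theorem aux_piece {K : Type*} [TopologicalSpace K] [CompactSpace K] (m : ℕ∞)
    (S : Finset ℚ) (ρ : ℝ) (hρ : 0 < ρ) (Θ : ℚ → C(K, ℝ) → ℝ) (hΘ : ∀ c, ContDiff ℝ m (Θ c))
    (hz : ∀ (c : ℚ) (h : C(K, ℝ)) (k : K), |h k - (c : ℝ)| < ρ → Θ c h = 0) (F : (K → Set ℚ) → ℝ) :
    ContDiff ℝ m (fun h => (∏ c ∈ S, Θ c h) * F (auxSig S h)) := by
  have hprod : ContDiff ℝ m (fun h => ∏ c ∈ S, Θ c h) := contDiff_prod fun c _ => hΘ c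
  rw [contDiff_iff_contDiffAt]
  intro h
  by_cases hcase : ∀ c ∈ S, ∀ k, ρ ≤ |h k - (c : ℝ)|
  · have : ContDiff ℝ m (fun h' => (∏ c ∈ S, Θ c h') * F (auxSig S h)) :=
      hprod.mul contDiff_const
    refine this.contDiffAt.congr_of_eventuallyEq ?_
    filter_upwards [Metric.ball_mem_nhds h hρ] with h' hh'
    rw [aux_sig_eq S h h' ρ hcase hh']
  · push Not at hcase
    obtain ⟨c, hc, k, hk⟩ := hcase
    have : ContDiff ℝ m (fun _ : C(K, ℝ) => (0 : ℝ)) := contDiff_const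
    refine this.contDiffAt.congr_of_eventuallyEq ?_
    have hcont : Continuous fun h' : C(K, ℝ) => |h' k - (c : ℝ)| :=
      ((continuous_eval_const k).sub continuous_const).abs
    filter_upwards [(hcont.tendsto h).eventually_lt_const hk] with h' hh'
    rw [Finset.prod_eq_zero hc (hz c h' k hh'), zero_mul]

/-- Existence of fine cuts. -/
theorem aux_cuts {K : Type*} [TopologicalSpace K] [CompactSpace K]
    (h : C(K, ℝ)) (hgap : ∀ a b : ℝ, a < b → ∃ t ∈ Set.Icc a b, ∀ k, h k ≠ t)
    (δ : ℝ) (hδ : 0 < δ) : ∃ (S : Finset ℚ) (n : ℕ),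
      (∀ c ∈ S, ∀ k, 3 * (1 / ((n : ℝ) + 1)) ≤ |h k - (c : ℝ)|) ∧
      ∀ h' : C(K, ℝ), auxSig S h' = auxSig S h → dist h' h ≤ δ := by
  have hcl : IsClosed (Set.range h) := (isCompact_range h.continuous).isClosed
  have hg : ∀ j : ℤ, ∃ c : ℚ, j * (δ / 3) < c ∧ (c : ℝ) < (j + 1) * (δ / 3) ∧
      ∃ r > 0, ∀ k, r ≤ |h k - (c : ℝ)| := by
    intro j
    obtain ⟨t, ⟨ht1, ht2⟩, ht⟩ := hgap (j * (δ / 3) + δ / 9) (j * (δ / 3) + 2 * δ / 9) (by linarith)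
    have hopen : IsOpen ((Set.range h)ᶜ ∩ Set.Ioo (j * (δ / 3)) ((j + 1) * (δ / 3))) :=
      hcl.isOpen_compl.inter isOpen_Ioo
    obtain ⟨_, ⟨hc1, hc2, hc3⟩, ⟨c, rfl⟩⟩ := Rat.denseRange_cast (𝕜 := ℝ) |>.inter_open_nonempty _ hopen
      ⟨t, by rintro ⟨k, hk⟩; exact ht k hk, by linarith, by linarith⟩
    refine ⟨c, hc2, hc3, ?_⟩
    obtain ⟨r, hr, hb⟩ := Metric.isOpen_iff.1 hcl.isOpen_compl _ hc1
    refine ⟨r, hr, fun k => ?_⟩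
    by_contra hlt
    exact hb (show h k ∈ Metric.ball (c : ℝ) r from by
      rw [Metric.mem_ball, Real.dist_eq]; exact not_le.1 hlt) ⟨k, rfl⟩
  choose c hc1 hc2 r hr hcr using hg
  obtain ⟨M, hM⟩ := exists_nat_gt (‖h‖ / (δ / 3) + 3)
  let I : Finset ℤ := Finset.Icc (-(M : ℤ)) M
  have hn : ∀ᶠ n : ℕ in atTop, ∀ j ∈ I, 3 * (1 / ((n : ℝ) + 1)) ≤ r j := by
    rw [Filter.eventually_all_finset]
    intro j _
    have : Tendsto (fun n : ℕ => 3 * (1 / ((n : ℝ) + 1))) atTop (𝓝 (3 * 0)) :=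
      tendsto_one_div_add_atTop_nhds_zero_nat.const_mul 3
    rw [mul_zero] at this
    filter_upwards [this.eventually_lt_const (hr j)] with n hn using hn.le
  obtain ⟨n, hn⟩ := hn.exists
  refine ⟨I.image c, n, ?_, ?_⟩
  · intro q hq k
    obtain ⟨j, hj, rfl⟩ := Finset.mem_image.1 hq
    exact (hn j hj).trans (hcr j k)
  · intro h' hh'
    rw [ContinuousMap.dist_le hδ.le]
    intro k
    have hd3 : 0 < δ / 3 := by linarith
    set j : ℤ := ⌊h k / (δ / 3)⌋ with hj
    have hj1 : (j : ℝ) * (δ / 3) ≤ h k := (le_div_iff₀ hd3).1 (Int.floor_le _)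
    have hj2 : h k < (j + 1 : ℝ) * (δ / 3) := (div_lt_iff₀ hd3).1 (Int.lt_floor_add_one _)
    have hk : |h k| ≤ ‖h‖ := h.norm_coe_le_norm k
    have hM' : ‖h‖ < (M - 3) * (δ / 3) := by
      rw [← div_lt_iff₀ hd3]; linarith
    have hk' := abs_le.1 hk
    have b1 : (j : ℝ) < M - 3 := by
      by_contra hcon
      have := mul_le_mul_of_nonneg_right (not_lt.1 hcon) hd3.le
      linarith
    have b2 : -(M : ℝ) + 3 < j + 1 := by
      by_contra hcon
      have := mul_le_mul_of_nonneg_right (not_lt.1 hcon) hd3.le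
      linarith
    have b1' : j < (M : ℤ) - 3 := by exact_mod_cast b1
    have b2' : -(M : ℤ) + 3 < j + 1 := by exact_mod_cast b2
    have m1 : c (j - 1) ∈ I.image c :=
      Finset.mem_image_of_mem c (Finset.mem_Icc.2 ⟨by omega, by omega⟩)
    have m2 : c (j + 1) ∈ I.image c :=
      Finset.mem_image_of_mem c (Finset.mem_Icc.2 ⟨by omega, by omega⟩)
    have e1 := hc1 (j - 1)
    have e2 := hc2 (j - 1)
    have e3 := hc1 (j + 1)
    have e4 := hc2 (j + 1)
    push_cast at e1 e2 e3 e4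
    have s1 : ¬ h' k < c (j - 1) := by
      intro hlt
      have : c (j - 1) ∈ auxSig (I.image c) h' k := ⟨m1, hlt⟩
      rw [hh'] at this
      have := this.2
      linarith
    have s2 : h' k < c (j + 1) := by
      have : c (j + 1) ∈ auxSig (I.image c) h k := ⟨m2, by linarith⟩
      rw [← hh'] at this
      exact this.2
    rw [Real.dist_eq, abs_le]
    constructor <;> linarith

theorem aux_main_s17 {K : Type*} [TopologicalSpace K] [CompactSpace K] (m : ℕ∞) (hm : m ≠ 0)
    (φ : C(K, ℝ) → ℝ) (hφ : ContDiff ℝ m φ) (h0 : φ 0 = 1) (R : ℝ)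
    (hR : 0 < R) (hs : ∀ x, R ≤ ‖x‖ → φ x = 0)
    (Φ : C(K, ℝ) → ℝ) (hΦ : Continuous Φ) (ε : ℝ) (hε : 0 < ε) :
    ∃ Ψ : C(K, ℝ) → ℝ, ContDiff ℝ m Ψ ∧ ∀ f : C(K, ℝ), |Φ f - Ψ f| ≤ ε := by
  classical
  have hdiff : Differentiable ℝ φ := hφ.differentiable (by exact_mod_cast hm)
  have hρ : ∀ n : ℕ, (0 : ℝ) < 1 / ((n : ℝ) + 1) := fun n => by positivity
  choose Θ hΘ hΘ0 hΘ1 hΘz hΘo using fun (n : ℕ) (c : ℚ) =>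
    aux_test m φ hφ h0 R hR hs (c : ℝ) (1 / ((n : ℝ) + 1)) (hρ n)
  let good : Finset ℚ → (K → Set ℚ) → Prop := fun S σ =>
    ∀ h1 h2 : C(K, ℝ), auxSig S h1 = σ → auxSig S h2 = σ → |Φ h1 - Φ h2| ≤ ε
  let χ : Finset ℚ → (K → Set ℚ) → ℝ := fun S σ => if good S σ then 1 else 0
  let v : Finset ℚ → (K → Set ℚ) → ℝ := fun S σ =>
    if hex : ∃ h : C(K, ℝ), auxSig S h = σ then Φ hex.choose else 0
  have hv : ∀ S h, ∃ h', auxSig S h' = auxSig S h ∧ v S (auxSig S h) = Φ h' := by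
    intro S h
    have hex : ∃ h' : C(K, ℝ), auxSig S h' = auxSig S h := ⟨h, rfl⟩
    exact ⟨hex.choose, hex.choose_spec, by simp only [v]; rw [dif_pos hex]⟩
  obtain ⟨e, he⟩ := exists_surjective_nat (Finset ℚ × ℕ)
  have hp0 : ∀ n S h, 0 ≤ ∏ c ∈ S, Θ n c h := fun n S h =>
    Finset.prod_nonneg fun c _ => hΘ0 n c h
  have hp1 : ∀ n S h, ∏ c ∈ S, Θ n c h ≤ 1 := fun n S h =>
    Finset.prod_le_one (fun c _ => hΘ0 n c h) fun c _ => hΘ1 n c h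
  refine aux_glue m Φ ε
    (fun i h => (∏ c ∈ (e i).1, Θ (e i).2 c h) * χ (e i).1 (auxSig (e i).1 h))
    (fun i h => (∏ c ∈ (e i).1, Θ (e i).2 c h) *
      (χ (e i).1 (auxSig (e i).1 h) * v (e i).1 (auxSig (e i).1 h))) ?_ ?_ ?_ ?_ ?_ ?_
  · intro i
    exact aux_piece m _ _ (hρ (e i).2) _ (hΘ (e i).2) (hΘz (e i).2) (χ (e i).1)
  · intro i
    exact aux_piece m _ _ (hρ (e i).2) _ (hΘ (e i).2) (hΘz (e i).2)
      (fun σ => χ (e i).1 σ * v (e i).1 σ)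
  · intro i h
    refine mul_nonneg (hp0 _ _ _) ?_
    simp only [χ]; split_ifs <;> norm_num
  · intro i h
    refine mul_le_one₀ (hp1 _ _ _) ?_ ?_ <;>
    · simp only [χ]; split_ifs <;> norm_num
  · intro i h
    by_cases hgd : good (e i).1 (auxSig (e i).1 h)
    · have hχ : χ (e i).1 (auxSig (e i).1 h) = 1 := if_pos hgd
      simp only [hχ, mul_one, one_mul]
      rw [← mul_sub, abs_mul, abs_of_nonneg (hp0 _ _ _), mul_comm ε]
      obtain ⟨h', h1, h2⟩ := hv (e i).1 h
      rw [h2]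
      exact mul_le_mul_of_nonneg_left (hgd h h' rfl h1) (hp0 _ _ _)
    · have hχ : χ (e i).1 (auxSig (e i).1 h) = 0 := if_neg hgd
      simp [hχ]
  · intro h
    obtain ⟨δ, hδ, hball⟩ := Metric.continuous_iff.1 hΦ h (ε / 2) (by linarith)
    obtain ⟨S, n, hS1, hS2⟩ := aux_cuts h (aux_gap φ hdiff h0 R hR hs h) (δ / 2) (by linarith)
    obtain ⟨i, hi⟩ := he (S, n)
    refine ⟨i, ?_⟩
    have hgd : good S (auxSig S h) := by
      intro h1 h2 e1 e2
      have d1 := hball h1 (by linarith [hS2 h1 e1])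
      have d2 := hball h2 (by linarith [hS2 h2 e2])
      rw [Real.dist_eq] at d1 d2
      have d1 := abs_lt.1 d1
      have d2 := abs_lt.1 d2
      rw [abs_le]
      constructor <;> linarith
    filter_upwards [Metric.ball_mem_nhds h (hρ n)] with h' hh'
    rw [hi]
    simp only
    have hsig : auxSig S h' = auxSig S h :=
      aux_sig_eq S h h' _ (fun c hc k => by linarith [hS1 c hc k, hρ n]) hh'
    have hχ : χ S (auxSig S h') = 1 := by rw [hsig]; exact if_pos hgd
    rw [hχ, mul_one]
    refine Finset.prod_eq_one fun c hc => hΘo n c h' fun k => ?_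
    have h2 : |h' k - h k| < 1 / ((n : ℝ) + 1) :=
      lt_of_le_of_lt (ContinuousMap.dist_apply_le_dist (f := h') (g := h) k) hh'
    have h3 := hS1 c hc k
    have h4 : |h k - (c : ℝ)| ≤ |h' k - c| + |h' k - h k| := by
      rw [abs_sub_comm (h' k) (h k), add_comm]
      exact abs_sub_le _ _ _
    linarith

theorem stmt_17 (K : Type*) [TopologicalSpace K] [CompactSpace K] [T2Space K]
    (m : ℕ∞) (hbump : ∃ b : C(K, ℝ) → ℝ, IsBumpOfClass m b)
    (Φ : C(K, ℝ) → ℝ) (hΦ : Continuous Φ) (ε : ℝ) (hε : 0 < ε) :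
    ∃ Ψ : C(K, ℝ) → ℝ, ContDiff ℝ (m : WithTop ℕ∞) Ψ ∧
      ∀ f : C(K, ℝ), |Φ f - Ψ f| ≤ ε := by
  by_cases hm : m = 0
  · subst hm
    refine ⟨Φ, ?_, fun f => by simpa using hε.le⟩
    exact contDiff_zero.2 hΦ
  obtain ⟨b, hb, ⟨x0, hx0⟩, s, hsb, hs⟩ := hbump
  obtain ⟨r, hr⟩ := hsb.exists_norm_le
  refine aux_main_s17 m hm (fun x => (b x0)⁻¹ * b (x + x0)) ?_ ?_ (|r| + ‖x0‖ + 1) (by positivity) ?_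
    Φ hΦ ε hε
  · exact contDiff_const.mul (hb.comp (contDiff_id.add contDiff_const))
  · simp [hx0]
  · intro x hx
    have : x + x0 ∉ s := by
      intro hmem
      have h1 := hr _ hmem
      have h2 : ‖x‖ ≤ ‖x + x0‖ + ‖x0‖ := by
        simpa using norm_sub_le (x + x0) x0
      linarith [le_abs_self r]
    simp [hs _ this]
end
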